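/- arXiv:1409.0103 — 3 statements merged into one kernel-verified Lean document; each statement's English description precedes it below -/
import Mathlib

section
/- Let α ≥ 0 and 0 < a < b with ψ_α(b, a) = 0 and φ_α(b, a) ≥ 0. Then for every x ∈ [a, b], ∫_a^b log(1/|x−t|)·f_{α,a,b}(t) dt + (1/2)(x² − 2α·log x) = C, where C = −(1/16)·(a² + 6ab + b² + 2(a−b)²·log((b−a)/4) − 4(a+b)² + 4(b²−a²)·log((b−a)/4)) − (α/√(ab))·((a+b)/2 − ((b−a)/2)·log((b−a)/4) − (a+b)·(1/2 + log 2 − (1/2)·log(b−a)) + √(ab)·log((√b + √a)/(√b − √a))). -/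
/-- `φ_α(x, a) = x + a − 2α/√(ax)` -/
noncomputable def phiFun (α x a : ℝ) : ℝ := x + a - 2 * α / Real.sqrt (a * x)

/-- `ψ_α(x, a) = (3/4)(x−a)² + a(x−a) + 2α√a/√x − 2α − 2` -/
noncomputable def psiFun (α x a : ℝ) : ℝ :=
  (3 / 4) * (x - a) ^ 2 + a * (x - a) + 2 * α * Real.sqrt a / Real.sqrt x - 2 * α - 2

/-- `f_{α,a,b}(x) = (1/(2π))·√((b−x)/(x−a))·(2x + b − a − 2α√(a/b)/x)` -/
noncomputable def densF (α a b x : ℝ) : ℝ :=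
  (1 / (2 * Real.pi)) * Real.sqrt ((b - x) / (x - a)) *
    (2 * x + b - a - 2 * α * Real.sqrt (a / b) / x)

open Real Filter Topology MeasureTheory

lemma ae_circleMap_ne (w : ℂ) : ∀ᵐ θ : ℝ, circleMap 0 1 θ ≠ w := by
  have h : (circleMap (0 : ℂ) 1 ⁻¹' {w}).Countable :=
    (Set.countable_singleton w).preimage_circleMap 0 one_ne_zero
  exact h.ae_notMem volume

lemma norm_sub_le_norm_sub_real_smul {z w : ℂ} (hz : ‖z‖ = 1) (hw : ‖w‖ = 1) {R : ℝ}
    (hR : 1 ≤ R) : ‖z - w‖ ≤ ‖z - R * w‖ := by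
  have hre : (z * (starRingEnd ℂ) w).re ≤ 1 :=
    (Complex.re_le_norm _).trans (by simp [hz, hw])
  have h1 : ‖z - w‖ ^ 2 = 2 - 2 * (z * (starRingEnd ℂ) w).re := by
    rw [← Complex.normSq_eq_norm_sq, Complex.normSq_sub, Complex.normSq_eq_norm_sq,
      Complex.normSq_eq_norm_sq, hz, hw]
    ring
  have h2 : ‖z - R * w‖ ^ 2 = 1 + R ^ 2 - 2 * R * (z * (starRingEnd ℂ) w).re := by
    rw [← Complex.normSq_eq_norm_sq, Complex.normSq_sub, Complex.normSq_eq_norm_sq,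
      Complex.normSq_eq_norm_sq, hz, norm_mul, hw, map_mul, Complex.conj_ofReal,
      mul_left_comm, Complex.re_ofReal_mul, Complex.norm_real, norm_eq_abs, mul_one, sq_abs]
    ring
  refine le_of_sq_le_sq ?_ (norm_nonneg _)
  nlinarith

/-- A potential of the unit circle at a boundary point is the radial limit from outside. -/
lemma circleAverage_mul_log_norm_sub_of_tendsto {g : ℂ → ℝ}
    (hg : ContinuousOn g (Metric.sphere 0 1)) {w : ℂ} (hw : ‖w‖ = 1) {F : ℝ → ℝ} {L : ℝ}
    (hF : ∀ R : ℝ, 1 < R → circleAverage (fun z ↦ g z * log ‖z - R * w‖) 0 1 = F R)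
    (hL : Tendsto F (𝓝[>] 1) (𝓝 L)) :
    circleAverage (fun z ↦ g z * log ‖z - w‖) 0 1 = L := by
  have hgc : Continuous fun θ ↦ g (circleMap 0 1 θ) :=
    hg.comp_continuous (continuous_circleMap 0 1) fun θ ↦ by simp
  have hnorm (θ : ℝ) : ‖circleMap 0 1 θ‖ = 1 := by simp
  have hI : Set.Ioo (1 : ℝ) 2 ∈ 𝓝[>] (1 : ℝ) := Ioo_mem_nhdsGT one_lt_two
  have hint : IntervalIntegrable (fun θ ↦ log ‖circleMap 0 1 θ - w‖) volume 0 (2 * π) :=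
    circleIntegrable_log_norm_sub_const (a := w) (c := 0) 1
  have hlim : Tendsto (fun R : ℝ ↦ circleAverage (fun z ↦ g z * log ‖z - R * w‖) 0 1) (𝓝[>] 1)
      (𝓝 (circleAverage (fun z ↦ g z * log ‖z - w‖) 0 1)) := by
    simp only [circleAverage_def]
    refine Tendsto.const_smul ?_ _
    refine intervalIntegral.tendsto_integral_filter_of_dominated_convergence
      (fun θ ↦ |g (circleMap 0 1 θ)| * (|log ‖circleMap 0 1 θ - w‖| + log 3)) ?_ ?_ ?_ ?_
    · refine Eventually.of_forall fun R ↦ Measurable.aestronglyMeasurable ?_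
      have hm : Measurable fun θ ↦ circleMap 0 1 θ - R * w :=
        ((continuous_circleMap 0 1).sub continuous_const).measurable
      exact hgc.measurable.mul hm.norm.log
    · filter_upwards [hI] with R hR
      filter_upwards [ae_circleMap_ne w] with θ hθ _
      rw [norm_mul, norm_eq_abs, norm_eq_abs]
      gcongr
      have h0 : 0 < ‖circleMap 0 1 θ - w‖ := norm_pos_iff.2 (sub_ne_zero.2 hθ)
      have h1 := norm_sub_le_norm_sub_real_smul (hnorm θ) hw hR.1.le
      have h2 : ‖circleMap 0 1 θ - R * w‖ ≤ 3 := by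
        refine (norm_sub_le _ _).trans ?_
        rw [hnorm, norm_mul, hw, Complex.norm_real, norm_eq_abs, abs_of_pos (by linarith [hR.1])]
        linarith [hR.2]
      have h3 := log_le_log h0 h1
      have h4 := log_le_log (h0.trans_le h1) h2
      have h5 : 0 ≤ log 3 := log_nonneg (by norm_num)
      rw [abs_le]
      constructor
      · linarith [neg_abs_le (log ‖circleMap 0 1 θ - w‖)]
      · linarith [abs_nonneg (log ‖circleMap 0 1 θ - w‖)]
    · exact (hint.abs.add intervalIntegrable_const).continuousOn_mul hgc.abs.continuousOn
    · filter_upwards [ae_circleMap_ne w] with θ hθ _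
      refine Tendsto.const_mul _ ?_
      refine (Tendsto.log (x := ‖circleMap 0 1 θ - w‖) ?_ ?_)
      · refine tendsto_nhdsWithin_of_tendsto_nhds ?_
        have : Continuous fun R : ℝ ↦ ‖circleMap 0 1 θ - R * w‖ := by fun_prop
        simpa using this.tendsto 1
      · exact norm_ne_zero_iff.2 (sub_ne_zero.2 hθ)
  refine tendsto_nhds_unique hlim (hL.congr' ?_)
  filter_upwards [self_mem_nhdsWithin] with R hR using (hF R hR).symm

lemma sub_ne_zero_of_norm_lt {z w : ℂ} (h : ‖z‖ < ‖w‖) : z - w ≠ 0 := by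
  rw [sub_ne_zero]; rintro rfl; exact h.ne rfl

lemma norm_real_mul_of_norm_eq_one {w : ℂ} (hw : ‖w‖ = 1) {R : ℝ} (hR : 1 < R) :
    ‖(R : ℂ) * w‖ = R := by
  rw [norm_mul, hw, mul_one, Complex.norm_real, norm_eq_abs, abs_of_pos (by linarith)]

lemma continuousOn_poissonKernel_sphere {p : ℂ} (hp : ‖p‖ < 1) :
    ContinuousOn (poissonKernel 0 p) (Metric.sphere 0 1) := by
  have : ∀ z ∈ Metric.sphere (0 : ℂ) 1, ‖z - p‖ ^ 2 ≠ 0 := fun z hz ↦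
    pow_ne_zero _ (by
      rw [norm_ne_zero_iff, ← neg_ne_zero, neg_sub]
      exact sub_ne_zero_of_norm_lt (by simpa [mem_sphere_zero_iff_norm.1 hz] using hp))
  simp only [funext (poissonKernel_def 0 p), sub_zero]
  fun_prop (disch := assumption)

lemma circleAverage_poissonKernel_mul_log_norm_sub {p w : ℂ} (hp : ‖p‖ < 1) (hw : ‖w‖ = 1) :
    circleAverage (fun z ↦ poissonKernel 0 p z * log ‖z - w‖) 0 1 = log ‖p - w‖ := by
  refine circleAverage_mul_log_norm_sub_of_tendsto (F := fun R ↦ log ‖p - R * w‖)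
    (continuousOn_poissonKernel_sphere hp) hw ?_ ?_
  · intro R hR
    have hf : InnerProductSpace.HarmonicOnNhd (fun z ↦ log ‖z - R * w‖)
        (Metric.closedBall 0 1) := by
      intro z hz
      refine AnalyticAt.harmonicAt_log_norm (f := fun z ↦ z - R * w) (by fun_prop) ?_
      refine sub_ne_zero_of_norm_lt ?_
      rw [norm_real_mul_of_norm_eq_one hw hR]
      exact (mem_closedBall_zero_iff.1 hz).trans_lt hR
    exact hf.circleAverage_poissonKernel_smul (w := p) (by simpa using hp)
  · refine tendsto_nhdsWithin_of_tendsto_nhds (Tendsto.log (x := ‖p - w‖) ?_ ?_)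
    · have : Continuous fun R : ℝ ↦ ‖p - R * w‖ := by fun_prop
      simpa using this.tendsto 1
    · exact norm_ne_zero_iff.2 (sub_ne_zero_of_norm_lt (by simpa [hw] using hp))

lemma circleAverage_inv_pow_mul {f : ℂ → ℂ} (k : ℕ)
    (hf : DifferentiableOn ℂ f (Metric.closedBall 0 1)) :
    circleAverage (fun z ↦ (z ^ k)⁻¹ * f z) 0 1 = iteratedDeriv k f 0 / k.factorial := by
  rw [circleAverage_eq_circleIntegral one_ne_zero]
  have h := hf.circleIntegral_one_div_sub_center_pow_smul one_pos k
  simp only [sub_zero, one_div, smul_eq_mul, pow_succ', mul_inv, mul_assoc] at h ⊢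
  rw [h]
  field_simp [Complex.two_pi_I_ne_zero]

lemma one_sub_div_mem_slitPlane {z w : ℂ} (h : ‖z‖ < ‖w‖) : 1 - z / w ∈ Complex.slitPlane := by
  refine Complex.mem_slitPlane_of_norm_lt_one (z := -(z / w)) ?_
  rwa [norm_neg, norm_div, div_lt_one ((norm_nonneg z).trans_lt h)]

lemma iteratedDeriv_log_one_sub_div {w : ℂ} (hw : w ≠ 0) (k : ℕ) :
    iteratedDeriv (k + 1) (fun z ↦ Complex.log (1 - z / w)) 0 = -(k.factorial / w ^ (k + 1)) := by
  have hd : deriv (fun z ↦ Complex.log (1 - z / w)) =ᶠ[𝓝 0] fun z ↦ (1 * z + -w)⁻¹ := by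
    filter_upwards [Metric.ball_mem_nhds (0 : ℂ) (norm_pos_iff.2 hw)] with z hz
    have hz' : ‖z‖ < ‖w‖ := by simpa using hz
    have h := (((hasDerivAt_id z).div_const w).const_sub 1).clog (one_sub_div_mem_slitPlane hz')
    have h0 := sub_ne_zero_of_norm_lt hz'
    have h1 : w - z ≠ 0 := by rwa [← neg_ne_zero, neg_sub]
    have h2 : 1 - z / w ≠ 0 := Complex.slitPlane_ne_zero (one_sub_div_mem_slitPlane hz')
    refine h.deriv.trans ?_
    simp only [id]
    rw [one_mul, ← sub_eq_add_neg, ← neg_sub w z, one_sub_div hw]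
    field_simp
  rw [iteratedDeriv_succ', hd.iteratedDeriv_eq, iteratedDeriv_eq_iterate, iter_deriv_inv_linear]
  simp only [mul_zero, zero_add, one_pow, mul_one]
  rw [show (-1 - (k : ℤ)) = -((k + 1 : ℕ) : ℤ) by push_cast; ring, zpow_neg, zpow_natCast,
    neg_pow w, mul_inv, div_eq_mul_inv, pow_succ (-1 : ℂ)]
  rcases neg_one_pow_eq_or ℂ k with h | h <;> rw [h] <;> norm_num

lemma circleAverage_re_pow {k : ℕ} (hk : k ≠ 0) :
    circleAverage (fun z : ℂ ↦ (z ^ k).re) 0 1 = 0 := by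
  have hd : Differentiable ℂ fun z : ℂ ↦ z ^ k := by fun_prop
  have h := hd.diffContOnCl (s := Metric.ball 0 |1|) |>.circleAverage
  have hi : CircleIntegrable (fun z : ℂ ↦ z ^ k) 0 1 :=
    hd.continuous.continuousOn.circleIntegrable zero_le_one
  have h2 := Complex.reCLM.circleAverage_comp_comm hi
  rw [h] at h2
  simpa [Function.comp_def, hk] using h2

lemma circleAverage_re_pow_mul_log_norm_sub_of_one_lt {k : ℕ} {w : ℂ} (hw : 1 < ‖w‖) :
    circleAverage (fun z ↦ (z ^ (k + 1)).re * log ‖z - w‖) 0 1 =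
      -((w ^ (k + 1))⁻¹).re / (2 * (k + 1)) := by
  have hw0 : w ≠ 0 := norm_pos_iff.1 (one_pos.trans hw)
  set h : ℂ → ℂ := fun z ↦ Complex.log (1 - z / w) with h_def
  have hd : DifferentiableOn ℂ h (Metric.closedBall 0 1) := by
    intro z hz
    have := one_sub_div_mem_slitPlane ((mem_closedBall_zero_iff.1 hz).trans_lt hw)
    have hq : DifferentiableAt ℂ (fun z ↦ 1 - z / w) z := by fun_prop
    exact (hq.clog this).differentiableWithinAt
  have hc : ContinuousOn h (Metric.sphere 0 1) :=
    hd.continuousOn.mono Metric.sphere_subset_closedBall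
  have hne : ∀ z ∈ Metric.sphere (0 : ℂ) 1, z ^ (k + 1) ≠ 0 := fun z hz ↦
    pow_ne_zero _ (ne_zero_of_mem_unit_sphere ⟨z, hz⟩)
  have hi1 : CircleIntegrable (fun z ↦ z ^ (k + 1) * h z) 0 1 :=
    ContinuousOn.circleIntegrable zero_le_one (by fun_prop)
  have hi2 : CircleIntegrable (fun z ↦ (z ^ (k + 1))⁻¹ * h z) 0 1 :=
    ContinuousOn.circleIntegrable zero_le_one (by fun_prop (disch := assumption))
  have e1 : circleAverage (fun z ↦ z ^ (k + 1) * h z) 0 1 = 0 := by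
    have : DiffContOnCl ℂ (fun z ↦ z ^ (k + 1) * h z) (Metric.ball 0 |1|) := by
      refine DifferentiableOn.diffContOnCl ?_
      rw [abs_one, closure_ball _ one_ne_zero]
      fun_prop
    simpa using this.circleAverage
  have e2 := circleAverage_inv_pow_mul (k + 1) hd
  rw [iteratedDeriv_log_one_sub_div hw0] at e2
  have e3 := Complex.reCLM.circleAverage_comp_comm (hi1.add hi2)
  rw [circleAverage_add hi1 hi2, e1, e2, zero_add] at e3
  have hre : ContinuousOn (fun z : ℂ ↦ (z ^ (k + 1)).re) (Metric.sphere 0 1) := by fun_prop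
  have hi3 : CircleIntegrable (fun z : ℂ ↦ log ‖w‖ • (z ^ (k + 1)).re) 0 1 :=
    ContinuousOn.circleIntegrable zero_le_one (by fun_prop)
  have hi4 : CircleIntegrable (fun z : ℂ ↦ (1 / 2 : ℝ) • (z ^ (k + 1) * h z +
      (z ^ (k + 1))⁻¹ * h z).re) 0 1 := by
    have hs : ContinuousOn (fun z ↦ z ^ (k + 1) * h z + (z ^ (k + 1))⁻¹ * h z)
        (Metric.sphere 0 1) := by fun_prop (disch := assumption)
    have hs' : ContinuousOn (fun z ↦ (1 / 2 : ℝ) • (z ^ (k + 1) * h z +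
        (z ^ (k + 1))⁻¹ * h z).re) (Metric.sphere 0 1) :=
      ContinuousOn.fun_smul continuousOn_const (Complex.continuous_re.comp_continuousOn hs)
    exact hs'.circleIntegrable zero_le_one
  have key : Set.EqOn (fun z ↦ (z ^ (k + 1)).re * log ‖z - w‖)
      (fun z ↦ log ‖w‖ • (z ^ (k + 1)).re +
        (1 / 2 : ℝ) • (z ^ (k + 1) * h z + (z ^ (k + 1))⁻¹ * h z).re)
      (Metric.sphere 0 |1|) := by
    intro z hz
    have hz1 : ‖z‖ = 1 := by simpa using hz
    have hz2 : ‖z ^ (k + 1)‖ = 1 := by rw [norm_pow, hz1, one_pow]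
    have h1 : 1 - z / w ≠ 0 := Complex.slitPlane_ne_zero (one_sub_div_mem_slitPlane (hz1 ▸ hw))
    have h2 : log ‖z - w‖ = log ‖w‖ + (h z).re := by
      rw [h_def, Complex.log_re, ← log_mul (norm_ne_zero_iff.2 hw0) (norm_ne_zero_iff.2 h1),
        ← norm_mul, mul_sub, mul_div_cancel₀ _ hw0, mul_one, norm_sub_rev]
    have h3 : (z ^ (k + 1))⁻¹ = (starRingEnd ℂ) (z ^ (k + 1)) := Complex.inv_eq_conj hz2
    simp only [h2, h3, smul_eq_mul, Complex.add_re, Complex.mul_re, Complex.conj_re,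
      Complex.conj_im]
    ring
  rw [circleAverage_congr_sphere key, circleAverage_fun_add hi3 hi4, circleAverage_fun_smul,
    circleAverage_re_pow k.succ_ne_zero, circleAverage_fun_smul, smul_zero, zero_add]
  have e4 : circleAverage (fun z ↦ (z ^ (k + 1) * h z + (z ^ (k + 1))⁻¹ * h z).re) 0 1 =
    (-((k.factorial : ℂ) / w ^ (k + 1)) / (k + 1).factorial).re := e3
  have e5 : -((k.factorial : ℂ) / w ^ (k + 1)) / (k + 1).factorial =
      ((-(1 / (k + 1)) : ℝ) : ℂ) * (w ^ (k + 1))⁻¹ := by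
    have : (k.factorial : ℂ) ≠ 0 := by exact_mod_cast k.factorial_ne_zero
    have : (k : ℂ) + 1 ≠ 0 := by exact_mod_cast k.succ_ne_zero
    rw [Nat.factorial_succ]
    push_cast
    field_simp
  rw [e4, e5, Complex.re_ofReal_mul, smul_eq_mul]
  have : (k : ℝ) + 1 ≠ 0 := by exact_mod_cast k.succ_ne_zero
  field_simp

lemma circleAverage_re_pow_mul_log_norm_sub {k : ℕ} {w : ℂ} (hw : ‖w‖ = 1) :
    circleAverage (fun z ↦ (z ^ (k + 1)).re * log ‖z - w‖) 0 1 =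
      -(w ^ (k + 1)).re / (2 * (k + 1)) := by
  refine circleAverage_mul_log_norm_sub_of_tendsto
    (F := fun R ↦ -(((R * w) ^ (k + 1))⁻¹).re / (2 * (k + 1))) (by fun_prop) hw ?_ ?_
  · intro R hR
    exact circleAverage_re_pow_mul_log_norm_sub_of_one_lt
      (by rwa [norm_real_mul_of_norm_eq_one hw hR])
  · refine tendsto_nhdsWithin_of_tendsto_nhds ?_
    have hw0 : w ≠ 0 := by rintro rfl; simp at hw
    have hc : ContinuousAt (fun R : ℝ ↦ -((((R : ℂ) * w) ^ (k + 1))⁻¹).re / (2 * (k + 1))) 1 := by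
      fun_prop (disch := simp [hw0])
    have h3 : ((w ^ (k + 1))⁻¹).re = (w ^ (k + 1)).re := by
      rw [Complex.inv_eq_conj (by rw [norm_pow, hw, one_pow]), Complex.conj_re]
    simpa [ContinuousAt, -inv_pow, h3] using hc

lemma circleAverage_poissonKernel {p : ℂ} (hp : ‖p‖ < 1) :
    circleAverage (poissonKernel 0 p) 0 1 = 1 := by
  have h := (diffContOnCl_const (c := (1 : ℂ)) (𝕜 := ℂ)
    (s := Metric.ball (0 : ℂ) 1)).circleAverage_poissonKernel_smul (w := p) (by simpa using hp)
  have hi : CircleIntegrable (poissonKernel 0 p • fun _ : ℂ ↦ (1 : ℂ)) 0 1 :=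
    ((continuousOn_poissonKernel_sphere hp).smul continuousOn_const).circleIntegrable zero_le_one
  have h2 := Complex.reCLM.circleAverage_comp_comm hi
  rw [h] at h2
  simpa [Function.comp_def] using h2

lemma circleAverage_trig_add_poissonKernel {p : ℂ} (hp : ‖p‖ < 1) (c₀ c₁ c₂ c₃ : ℝ) :
    circleAverage (fun z : ℂ ↦ c₀ + c₁ * (z ^ 1).re + c₂ * (z ^ 2).re + c₃ * poissonKernel 0 p z)
      0 1 = c₀ + c₃ := by
  have hP := continuousOn_poissonKernel_sphere hp
  have h1 : CircleIntegrable (fun z : ℂ ↦ c₁ • (z ^ 1).re) 0 1 :=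
    ContinuousOn.circleIntegrable zero_le_one (by fun_prop)
  have h2 : CircleIntegrable (fun z : ℂ ↦ c₂ • (z ^ 2).re) 0 1 :=
    ContinuousOn.circleIntegrable zero_le_one (by fun_prop)
  have h3 : CircleIntegrable (fun z : ℂ ↦ c₃ • poissonKernel 0 p z) 0 1 :=
    ContinuousOn.circleIntegrable zero_le_one (by fun_prop)
  have h0 : CircleIntegrable (fun _ : ℂ ↦ c₀) 0 1 :=
    ContinuousOn.circleIntegrable zero_le_one (by fun_prop)
  change circleAverage ((fun _ : ℂ ↦ c₀) + (fun z ↦ c₁ • (z ^ 1).re) +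
    (fun z ↦ c₂ • (z ^ 2).re) + fun z ↦ c₃ • poissonKernel 0 p z) 0 1 = _
  rw [circleAverage_add ((h0.add h1).add h2) h3, circleAverage_add (h0.add h1) h2,
    circleAverage_add h0 h1, circleAverage_fun_smul, circleAverage_fun_smul,
    circleAverage_fun_smul, circleAverage_const, circleAverage_re_pow one_ne_zero,
    circleAverage_re_pow two_ne_zero, circleAverage_poissonKernel hp]
  simp

lemma circleIntegrable_mul_log_norm_sub {g : ℂ → ℝ} (hg : ContinuousOn g (Metric.sphere 0 1))
    (w : ℂ) : CircleIntegrable (fun z ↦ g z * log ‖z - w‖) 0 1 :=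
  IntervalIntegrable.continuousOn_mul (circleIntegrable_log_norm_sub_const (a := w) (c := 0) 1)
    (hg.comp_continuous (continuous_circleMap 0 1) fun θ ↦ by simp).continuousOn

lemma circleAverage_trig_add_poissonKernel_mul_log_norm_sub {p w : ℂ} (hp : ‖p‖ < 1)
    (hw : ‖w‖ = 1) (c₀ c₁ c₂ c₃ : ℝ) :
    circleAverage (fun z : ℂ ↦ (c₀ + c₁ * (z ^ 1).re + c₂ * (z ^ 2).re +
      c₃ * poissonKernel 0 p z) * log ‖z - w‖) 0 1 =
      -(c₁ / 2) * w.re - c₂ / 4 * (w ^ 2).re + c₃ * log ‖p - w‖ := by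
  have hP := continuousOn_poissonKernel_sphere hp
  have hI {g : ℂ → ℝ} (c : ℝ) (hg : ContinuousOn g (Metric.sphere 0 1)) :
      CircleIntegrable (fun z ↦ c • (g z * log ‖z - w‖)) 0 1 :=
    (circleIntegrable_mul_log_norm_sub hg w).const_mul c
  have h0 := hI (g := fun _ ↦ 1) c₀ (by fun_prop)
  have h1 := hI (g := fun z ↦ (z ^ 1).re) c₁ (by fun_prop)
  have h2 := hI (g := fun z ↦ (z ^ 2).re) c₂ (by fun_prop)
  have h3 := hI c₃ hP
  have e0 : circleAverage (fun z ↦ 1 * log ‖z - w‖) 0 1 = 0 := by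
    simpa using circleAverage_log_norm_sub_const₁ hw
  have e1 := circleAverage_re_pow_mul_log_norm_sub (k := 0) hw
  have e2 := circleAverage_re_pow_mul_log_norm_sub (k := 1) hw
  simp only [zero_add, Nat.reduceAdd] at e1 e2
  have : (fun z : ℂ ↦ (c₀ + c₁ * (z ^ 1).re + c₂ * (z ^ 2).re +
      c₃ * poissonKernel 0 p z) * log ‖z - w‖) = (fun z ↦ c₀ • (1 * log ‖z - w‖)) +
      (fun z ↦ c₁ • ((z ^ 1).re * log ‖z - w‖)) + (fun z ↦ c₂ • ((z ^ 2).re * log ‖z - w‖)) +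
      fun z ↦ c₃ • (poissonKernel 0 p z * log ‖z - w‖) := by
    ext z
    simp only [smul_eq_mul, Pi.add_apply]
    ring
  rw [this, circleAverage_add ((h0.add h1).add h2) h3, circleAverage_add (h0.add h1) h2,
    circleAverage_add h0 h1, circleAverage_fun_smul, circleAverage_fun_smul,
    circleAverage_fun_smul, circleAverage_fun_smul, e0, e1, e2,
    circleAverage_poissonKernel_mul_log_norm_sub hp hw]
  simp only [smul_eq_mul, pow_one]
  push_cast
  ring

lemma circleMap_zero_one_re (θ : ℝ) : (circleMap 0 1 θ).re = cos θ := by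
  simp [circleMap, Complex.exp_ofReal_mul_I_re]

lemma intervalIntegrable_comp_cos {F : ℝ → ℝ} (hF : CircleIntegrable (fun z ↦ F z.re) 0 1) :
    IntervalIntegrable (fun θ ↦ F (cos θ)) volume 0 (2 * π) := by
  simpa only [CircleIntegrable, circleMap_zero_one_re] using hF

lemma integrableOn_comp_cos {F : ℝ → ℝ} (hF : CircleIntegrable (fun z ↦ F z.re) 0 1) :
    IntegrableOn (fun θ ↦ F (cos θ)) (Set.Ioo 0 π) := by
  have hF' := intervalIntegrable_comp_cos hF
  rw [intervalIntegrable_iff_integrableOn_Ioo_of_le two_pi_pos.le] at hF'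
  exact hF'.mono_set (Set.Ioo_subset_Ioo_right (by linarith [pi_pos]))

lemma circleAverage_comp_re {F : ℝ → ℝ} (hF : CircleIntegrable (fun z ↦ F z.re) 0 1) :
    circleAverage (fun z ↦ F z.re) 0 1 = π⁻¹ * ∫ θ in Set.Ioo 0 π, F (cos θ) := by
  have hF' := intervalIntegrable_comp_cos hF
  have hπ := pi_pos
  have hmem : π ∈ Set.uIcc 0 (2 * π) := by
    rw [Set.uIcc_of_le (by linarith)]
    exact ⟨hπ.le, by linarith⟩
  have h1 : IntervalIntegrable (fun θ ↦ F (cos θ)) volume 0 π :=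
    hF'.mono_set (Set.uIcc_subset_uIcc Set.left_mem_uIcc hmem)
  have h2 : IntervalIntegrable (fun θ ↦ F (cos θ)) volume π (2 * π) :=
    hF'.mono_set (Set.uIcc_subset_uIcc hmem Set.right_mem_uIcc)
  have h3 : ∫ θ in π..2 * π, F (cos θ) = ∫ θ in 0..π, F (cos θ) := by
    have := intervalIntegral.integral_comp_sub_left (a := 0) (b := π) (fun θ ↦ F (cos θ)) (2 * π)
    simp only [cos_two_pi_sub, sub_zero] at this
    rw [this]
    congr 1
    ring
  simp only [circleAverage_def, circleMap_zero_one_re]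
  rw [← intervalIntegral.integral_add_adjacent_intervals h1 h2, h3, ← integral_Ioc_eq_integral_Ioo,
    ← intervalIntegral.integral_of_le hπ.le, smul_eq_mul]
  field_simp
  ring

lemma log_norm_sub_add_log_norm_sub_conj {z w : ℂ} (hz : ‖z‖ = 1) (hw : ‖w‖ = 1) (h1 : z ≠ w)
    (h2 : z ≠ (starRingEnd ℂ) w) :
    log ‖z - w‖ + log ‖z - (starRingEnd ℂ) w‖ = log (2 * |z.re - w.re|) := by
  rw [← log_mul (norm_ne_zero_iff.2 (sub_ne_zero.2 h1)) (norm_ne_zero_iff.2 (sub_ne_zero.2 h2)),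
    ← norm_mul]
  have hz' : z * (starRingEnd ℂ) z = 1 := by
    simp [Complex.mul_conj, Complex.normSq_eq_norm_sq, hz]
  have hw' : w * (starRingEnd ℂ) w = 1 := by
    simp [Complex.mul_conj, Complex.normSq_eq_norm_sq, hw]
  have : (z - w) * (z - (starRingEnd ℂ) w) = z * ((2 * (z.re - w.re) : ℝ) : ℂ) := by
    have e1 := Complex.add_conj z
    have e2 := Complex.add_conj w
    push_cast at e1 e2 ⊢
    linear_combination hw' - hz' + z * e1 - z * e2
  rw [this, norm_mul, hz, one_mul, Complex.norm_real, norm_eq_abs, abs_mul, abs_two]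

/-- Logarithmic potential in the angular variable, from the potentials at the two boundary points
of the unit circle with the given real part. -/
lemma integral_mul_log_two_mul_abs_cos_sub {G : ℝ → ℝ}
    (hG : ContinuousOn (fun z : ℂ ↦ G z.re) (Metric.sphere 0 1)) {w : ℂ} (hw : ‖w‖ = 1) {V : ℝ}
    (h1 : circleAverage (fun z ↦ G z.re * log ‖z - w‖) 0 1 = V)
    (h2 : circleAverage (fun z ↦ G z.re * log ‖z - (starRingEnd ℂ) w‖) 0 1 = V) :
    CircleIntegrable (fun z ↦ G z.re * log (2 * |z.re - w.re|)) 0 1 ∧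
    ∫ θ in Set.Ioo 0 π, G (cos θ) * log (2 * |cos θ - w.re|) = 2 * π * V := by
  have i1 := circleIntegrable_mul_log_norm_sub hG w
  have i2 := circleIntegrable_mul_log_norm_sub hG ((starRingEnd ℂ) w)
  have hae : ∀ᵐ θ : ℝ, G (circleMap 0 1 θ).re * log ‖circleMap 0 1 θ - w‖ +
      G (circleMap 0 1 θ).re * log ‖circleMap 0 1 θ - (starRingEnd ℂ) w‖ =
      G (circleMap 0 1 θ).re * log (2 * |(circleMap 0 1 θ).re - w.re|) := by
    filter_upwards [ae_circleMap_ne w, ae_circleMap_ne ((starRingEnd ℂ) w)] with θ ha hb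
    rw [← mul_add, log_norm_sub_add_log_norm_sub_conj (by simp) hw ha hb]
  have hi : CircleIntegrable (fun z ↦ G z.re * log (2 * |z.re - w.re|)) 0 1 :=
    (i1.add i2).congr_ae (ae_restrict_of_ae hae)
  refine ⟨hi, ?_⟩
  have e : circleAverage (fun z ↦ G z.re * log (2 * |z.re - w.re|)) 0 1 = V + V := by
    rw [← congrArg₂ (· + ·) h1 h2, ← circleAverage_fun_add i1 i2]
    simp only [circleAverage_def]
    congr 1
    exact intervalIntegral.integral_congr_ae (hae.mono fun θ h _ ↦ h.symm)
  rw [circleAverage_comp_re (F := fun c ↦ G c * log (2 * |c - w.re|)) hi] at e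
  have hπ := pi_ne_zero
  field_simp at e
  linarith

lemma image_add_mul_cos_Ioo (m : ℝ) {r : ℝ} (hr : 0 < r) :
    (fun θ ↦ m + r * cos θ) '' Set.Ioo 0 π = Set.Ioo (m - r) (m + r) := by
  ext t
  constructor
  · rintro ⟨θ, ⟨h0, hπ⟩, rfl⟩
    have h1 : cos θ < 1 := by
      simpa using cos_lt_cos_of_nonneg_of_le_pi le_rfl hπ.le h0
    have h2 : -1 < cos θ := by
      simpa using cos_lt_cos_of_nonneg_of_le_pi h0.le le_rfl hπ
    constructor <;> simp only <;> nlinarith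
  · rintro ⟨h1, h2⟩
    have h3 : -1 < (t - m) / r := by rw [lt_div_iff₀ hr]; linarith
    have h4 : (t - m) / r < 1 := by rw [div_lt_one hr]; linarith
    refine ⟨arccos ((t - m) / r), ⟨arccos_pos.2 h4, ?_⟩, ?_⟩
    · refine lt_of_le_of_ne (arccos_le_pi _) fun h ↦ ?_
      exact absurd (arccos_eq_pi.1 h) (not_le.2 h3)
    · simp only
      rw [cos_arccos h3.le h4.le, mul_div_cancel₀ _ hr.ne']
      ring

lemma setIntegral_Ioo_eq_integral_cos (m : ℝ) {r : ℝ} (hr : 0 < r) (f : ℝ → ℝ) :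
    ∫ t in Set.Ioo (m - r) (m + r), f t =
      ∫ θ in Set.Ioo 0 π, r * sin θ * f (m + r * cos θ) := by
  have hd : ∀ θ ∈ Set.Ioo 0 π,
      HasDerivWithinAt (fun θ ↦ m + r * cos θ) (r * -sin θ) (Set.Ioo 0 π) θ := fun θ _ ↦
    (((hasDerivAt_cos θ).const_mul r).const_add m).hasDerivWithinAt
  have hinj : Set.InjOn (fun θ ↦ m + r * cos θ) (Set.Ioo 0 π) := by
    intro s hs t ht h
    exact injOn_cos (Set.Ioo_subset_Icc_self hs) (Set.Ioo_subset_Icc_self ht)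
      (mul_left_cancel₀ hr.ne' (add_left_cancel h))
  rw [← image_add_mul_cos_Ioo m hr,
    integral_image_eq_integral_abs_deriv_smul measurableSet_Ioo hd hinj]
  refine setIntegral_congr_fun measurableSet_Ioo fun θ hθ ↦ ?_
  have hs : 0 < sin θ := sin_pos_of_mem_Ioo hθ
  simp only [smul_eq_mul]
  rw [abs_mul, abs_neg, abs_of_pos hr, abs_of_pos hs]

lemma sin_mul_sqrt_one_sub_cos_div {θ : ℝ} (hθ : θ ∈ Set.Ioo 0 π) :
    sin θ * √((1 - cos θ) / (1 + cos θ)) = 1 - cos θ := by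
  have hs : 0 < sin θ := sin_pos_of_mem_Ioo hθ
  have hsq := sin_sq_add_cos_sq θ
  have h1 : 0 < 1 + cos θ := by nlinarith [neg_one_le_cos θ, cos_le_one θ]
  have h : (1 - cos θ) / (1 + cos θ) = ((1 - cos θ) / sin θ) ^ 2 := by
    field_simp
    linear_combination (1 - cos θ) * hsq
  rw [h, sqrt_sq (div_nonneg (by linarith [cos_le_one θ]) hs.le), mul_div_cancel₀ _ hs.ne']

/-- With `a = u²`, `b = v²` and `t = (a + b) / 2 + (b - a) / 2 * z.re` for `z` on the unit circle,
the Poisson kernel with pole `-(v - u) / (v + u)` is `√(ab) / t`. -/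
lemma poissonKernel_neg_sub_div_add {u v : ℝ} (hu : 0 < u) (huv : u < v) {z : ℂ} (hz : ‖z‖ = 1) :
    poissonKernel 0 ((-((v - u) / (v + u)) : ℝ) : ℂ) z =
      u * v / ((u ^ 2 + v ^ 2) / 2 + (v ^ 2 - u ^ 2) / 2 * z.re) ∧
    ‖((-((v - u) / (v + u)) : ℝ) : ℂ) - z‖ ^ 2 =
      ((u ^ 2 + v ^ 2) / 2 + (v ^ 2 - u ^ 2) / 2 * z.re) / ((u + v) / 2) ^ 2 := by
  have hpos : 0 < v + u := by linarith
  have h1 : z.re ^ 2 + z.im ^ 2 = 1 := by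
    have := Complex.normSq_eq_norm_sq z
    rw [hz, Complex.normSq_apply] at this
    linarith
  have h2 : ‖((-((v - u) / (v + u)) : ℝ) : ℂ) - z‖ ^ 2 =
      ((u ^ 2 + v ^ 2) / 2 + (v ^ 2 - u ^ 2) / 2 * z.re) / ((u + v) / 2) ^ 2 := by
    rw [← Complex.normSq_eq_norm_sq, Complex.normSq_apply]
    simp only [Complex.sub_re, Complex.sub_im, Complex.ofReal_re, Complex.ofReal_im]
    have : u + v ≠ 0 := by linarith
    field_simp
    linear_combination (v + u) ^ 4 * h1
  refine ⟨?_, h2⟩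
  have h3 : -1 ≤ z.re := by nlinarith [sq_nonneg z.im]
  have h4 : 0 < (u ^ 2 + v ^ 2) / 2 + (v ^ 2 - u ^ 2) / 2 * z.re := by
    nlinarith [mul_pos (sub_pos.2 huv) hpos]
  rw [poissonKernel_def, sub_zero, sub_zero, norm_sub_rev, h2, hz, Complex.norm_real, norm_eq_abs,
    sq_abs]
  have : u + v ≠ 0 := by linarith
  field_simp
  ring

lemma integral_log_mul_densF (α : ℝ) {u v : ℝ} (hu : 0 < u) (huv : u < v) {c : ℝ}
    (hc : c ∈ Set.Icc (-1) 1) {m r x : ℝ} (hm : m = (u ^ 2 + v ^ 2) / 2)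
    (hr : r = (v ^ 2 - u ^ 2) / 2) (hx : x = m + r * c) :
    ∫ t in Set.Ioo (u ^ 2) (v ^ 2), log (1 / |x - t|) * densF α (u ^ 2) (v ^ 2) t =
      -(log (r / 2) * ((3 * r ^ 2 + 2 * u ^ 2 * r + 2 * α * (u / v) - 2 * α) / 2)) -
        m * r * c - r ^ 2 / 4 * (2 * c ^ 2 - 1) + α * (log x - 2 * log ((u + v) / 2)) := by
  have hv : 0 < v := hu.trans huv
  have hr0 : 0 < r := by rw [hr]; nlinarith
  have ht (y : ℝ) (hy : y ∈ Set.Icc (-1) 1) : 0 < m + r * y := by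
    rw [hm, hr]; nlinarith [hy.1, mul_pos (sub_pos.2 huv) (add_pos hu hv)]
  set q : ℝ := -((v - u) / (v + u)) with hq
  have hq1 : ‖(q : ℂ)‖ < 1 := by
    rw [Complex.norm_real, norm_eq_abs, hq, abs_neg,
      abs_of_pos (div_pos (by linarith) (by linarith)), div_lt_one (by linarith)]
    linarith
  set G : ℝ → ℝ := fun y ↦
    r * (1 - y) * (2 * (m + r * y) + v ^ 2 - u ^ 2 - 2 * α * (u / v) / (m + r * y)) with hG
  set A : ℝ := 3 * r ^ 2 + 2 * u ^ 2 * r + 2 * α * (u / v) with hA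
  have hre {z : ℂ} (hz : ‖z‖ = 1) : z.re ∈ Set.Icc (-1) 1 :=
    abs_le.1 ((Complex.abs_re_le_norm z).trans hz.le)
  have hGA : Set.EqOn (fun z : ℂ ↦ G z.re) (fun z : ℂ ↦ A + -(2 * m * r) * (z ^ 1).re +
      -r ^ 2 * (z ^ 2).re + -(2 * α) * poissonKernel 0 q z) (Metric.sphere 0 1) := by
    intro z hz
    have hz1 : ‖z‖ = 1 := by simpa using hz
    have h1 : (z ^ 2).re = 2 * z.re ^ 2 - 1 := by
      have := Complex.normSq_eq_norm_sq z
      rw [hz1, Complex.normSq_apply] at this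
      rw [pow_two, Complex.mul_re]
      linarith
    have h0 := (ht _ (hre hz1)).ne'
    simp only [hG, hA]
    rw [h1, (poissonKernel_neg_sub_div_add hu huv hz1).1, pow_one, ← hm, ← hr]
    have hr' : r * (1 - z.re) = v ^ 2 - (m + r * z.re) := by rw [hm, hr]; ring
    have hv2 : v ^ 2 = u ^ 2 + 2 * r := by rw [hr]; ring
    have hm2 : m = u ^ 2 + r := by rw [hm, hr]; ring
    rw [hr', mul_sub]
    have e1 : (v ^ 2 - (m + r * z.re)) * (2 * α * (u / v) / (m + r * z.re)) =
        2 * α * (u * v / (m + r * z.re)) - 2 * α * (u / v) := by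
      field_simp
    rw [e1, hv2, hm2]
    ring
  have hGc : ContinuousOn (fun z : ℂ ↦ G z.re) (Metric.sphere 0 1) := by
    have := continuousOn_poissonKernel_sphere hq1
    exact ContinuousOn.congr (by fun_prop) hGA
  have havg : circleAverage (fun z ↦ G z.re) 0 1 = A - 2 * α := by
    rw [circleAverage_congr_sphere (by rwa [abs_one]), circleAverage_trig_add_poissonKernel hq1]
    ring
  have hGi : CircleIntegrable (fun z ↦ G z.re) 0 1 := hGc.circleIntegrable zero_le_one
  have hint1 : ∫ θ in Set.Ioo 0 π, G (cos θ) = π * (A - 2 * α) := by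
    rw [← havg, circleAverage_comp_re hGi, mul_inv_cancel_left₀ pi_ne_zero]
  have hpot (w : ℂ) (hw : ‖w‖ = 1) (hwc : w.re = c) :
      circleAverage (fun z ↦ G z.re * log ‖z - w‖) 0 1 =
        m * r * c + r ^ 2 / 4 * (2 * c ^ 2 - 1) - α * (log x - 2 * log ((u + v) / 2)) := by
    have h1 : Set.EqOn (fun z : ℂ ↦ G z.re * log ‖z - w‖) _ (Metric.sphere 0 |1|) :=
      fun z hz ↦ congrArg (· * log ‖z - w‖) (hGA (by rwa [abs_one] at hz))
    rw [circleAverage_congr_sphere h1,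
      circleAverage_trig_add_poissonKernel_mul_log_norm_sub hq1 hw]
    have h2 : (w ^ 2).re = 2 * c ^ 2 - 1 := by
      have := Complex.normSq_eq_norm_sq w
      rw [hw, Complex.normSq_apply, hwc] at this
      rw [pow_two, Complex.mul_re, hwc]
      linarith
    have h3 := congrArg log (poissonKernel_neg_sub_div_add hu huv hw).2
    rw [hwc, ← hm, ← hr, ← hx, log_pow, log_div (hx ▸ (ht c hc).ne') (by positivity),
      log_pow] at h3
    rw [Nat.cast_ofNat] at h3
    rw [h2, hwc]
    linear_combination (-α) * h3
  have hc2 : 0 ≤ 1 - c ^ 2 := by nlinarith [hc.1, hc.2]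
  set w : ℂ := ⟨c, √(1 - c ^ 2)⟩ with hwd
  have hw : ‖w‖ = 1 := by
    rw [← sq_eq_sq₀ (norm_nonneg _) zero_le_one, ← Complex.normSq_eq_norm_sq, Complex.normSq_apply]
    simp only [hwd]
    rw [mul_self_sqrt hc2]
    ring
  obtain ⟨hi2, hint2⟩ := integral_mul_log_two_mul_abs_cos_sub hGc hw (hpot w hw rfl)
    (hpot _ (by simpa using hw) (by simp [hwd]))
  have hwre : w.re = c := rfl
  rw [hwre] at hint2 hi2
  rw [show u ^ 2 = m - r by rw [hm, hr]; ring, show v ^ 2 = m + r by rw [hm, hr]; ring,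
    setIntegral_Ioo_eq_integral_cos m hr0]
  have hcongr : ∀ᵐ θ : ℝ, θ ∈ Set.Ioo 0 π →
      r * sin θ * (log (1 / |x - (m + r * cos θ)|) * densF α (m - r) (m + r) (m + r * cos θ)) =
      -(1 / (2 * π)) * (log (r / 2) * G (cos θ) + G (cos θ) * log (2 * |cos θ - c|)) := by
    filter_upwards [compl_mem_ae_iff.2 (measure_singleton (arccos c))] with θ hθ hθI
    have hne : cos θ - c ≠ 0 := fun h ↦ hθ <| by
      rw [← sub_eq_zero.1 h, arccos_cos hθI.1.le hθI.2.le]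
      exact Set.mem_singleton θ
    have h1 : log (1 / |x - (m + r * cos θ)|) = -(log (r / 2) + log (2 * |cos θ - c|)) := by
      rw [one_div, log_inv, ← log_mul (by positivity) (by positivity)]
      congr 2
      rw [hx, show m + r * c - (m + r * cos θ) = r * -(cos θ - c) by ring, abs_mul, abs_neg,
        abs_of_pos hr0]
      ring
    have h2 : ((m + r) - (m + r * cos θ)) / (m + r * cos θ - (m - r)) =
        (1 - cos θ) / (1 + cos θ) := by
      rw [show (m + r) - (m + r * cos θ) = r * (1 - cos θ) by ring,
        show m + r * cos θ - (m - r) = r * (1 + cos θ) by ring, mul_div_mul_left _ _ hr0.ne']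
    have h3 : √((m - r) / (m + r)) = u / v := by
      rw [show m - r = u ^ 2 by rw [hm, hr]; ring, show m + r = v ^ 2 by rw [hm, hr]; ring,
        ← div_pow, sqrt_sq (by positivity)]
    have h4 : G (cos θ) = r * (1 - cos θ) * (2 * (m + r * cos θ) + (m + r) - (m - r) -
        2 * α * (u / v) / (m + r * cos θ)) := by
      simp only [hG]
      rw [show m - r = u ^ 2 by rw [hm, hr]; ring, show m + r = v ^ 2 by rw [hm, hr]; ring]
    rw [densF, h1, h2, h3, h4]
    linear_combination (-(1 / (2 * π)) * r * (log (r / 2) + log (2 * |cos θ - c|)) *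
      (2 * (m + r * cos θ) + (m + r) - (m - r) - 2 * α * (u / v) / (m + r * cos θ))) *
      sin_mul_sqrt_one_sub_cos_div hθI
  rw [setIntegral_congr_ae measurableSet_Ioo hcongr, integral_const_mul,
    integral_add ((integrableOn_comp_cos hGi).const_mul _) (integrableOn_comp_cos
      (F := fun y ↦ G y * log (2 * |y - c|)) hi2), integral_const_mul, hint1, hint2]
  have hu2 : u ^ 2 = m - r := by rw [hm, hr]; ring
  have hπ := pi_ne_zero
  field_simp
  ring
/-- The explicit value of the (modified) Robin constant: on `[a, b]`,
`∫_a^b log(1/|x−t|) f_{α,a,b}(t) dt + (1/2)(x² − 2α log x) = C` with `C` explicit. -/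
theorem robin_constant (α a b : ℝ) (hα : 0 ≤ α) (ha : 0 < a) (hab : a < b)
    (hψ : psiFun α b a = 0) (hφ : 0 ≤ phiFun α b a) :
    ∀ x ∈ Set.Icc a b,
      (∫ t in Set.Ioo a b, Real.log (1 / |x - t|) * densF α a b t) +
          (1 / 2) * (x ^ 2 - 2 * α * Real.log x) =
        -(1 / 16) *
            (a ^ 2 + 6 * a * b + b ^ 2 + 2 * (a - b) ^ 2 * Real.log ((b - a) / 4) -
              4 * (a + b) ^ 2 + 4 * (b ^ 2 - a ^ 2) * Real.log ((b - a) / 4)) -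
          (α / Real.sqrt (a * b)) *
            ((a + b) / 2 - ((b - a) / 2) * Real.log ((b - a) / 4) -
              (a + b) * (1 / 2 + Real.log 2 - (1 / 2) * Real.log (b - a)) +
              Real.sqrt (a * b) *
                Real.log ((Real.sqrt b + Real.sqrt a) / (Real.sqrt b - Real.sqrt a))) := by
  intro x hx
  obtain ⟨u, hu, rfl⟩ : ∃ u : ℝ, 0 < u ∧ a = u ^ 2 := ⟨√a, sqrt_pos.2 ha, (sq_sqrt ha.le).symm⟩
  have hb : 0 < b := ha.trans hab
  obtain ⟨v, hv, rfl⟩ : ∃ v : ℝ, 0 < v ∧ b = v ^ 2 := ⟨√b, sqrt_pos.2 hb, (sq_sqrt hb.le).symm⟩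
  have huv : u < v := lt_of_pow_lt_pow_left₀ 2 hv.le hab
  have hd : 0 < v - u := sub_pos.2 huv
  have hs : 0 < v + u := add_pos hv hu
  have hr : 0 < (v ^ 2 - u ^ 2) / 2 := by linarith
  have key := integral_log_mul_densF α hu huv
    (c := (x - (u ^ 2 + v ^ 2) / 2) / ((v ^ 2 - u ^ 2) / 2))
    ⟨by rw [le_div_iff₀ hr]; linarith [hx.1], by rw [div_le_one hr]; linarith [hx.2]⟩
    rfl rfl (x := x) (by rw [mul_div_cancel₀ _ hr.ne']; ring)
  have hfac : v ^ 2 - u ^ 2 = (v - u) * (v + u) := by ring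
  have l4 : log 4 = 2 * log 2 := by rw [show (4 : ℝ) = 2 ^ 2 by norm_num, log_pow]; norm_num
  have e1 : log ((v ^ 2 - u ^ 2) / 2 / 2) = log (v - u) + log (v + u) - 2 * log 2 := by
    rw [div_div, show (2 : ℝ) * 2 = 4 by norm_num, log_div (by positivity) (by norm_num), hfac,
      log_mul hd.ne' hs.ne', l4]
  have e2 : log ((v ^ 2 - u ^ 2) / 4) = log (v - u) + log (v + u) - 2 * log 2 := by
    rw [← e1]; congr 1; ring
  have e3 : log (v ^ 2 - u ^ 2) = log (v - u) + log (v + u) := by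
    rw [hfac, log_mul hd.ne' hs.ne']
  have e4 : log ((u + v) / 2) = log (v + u) - log 2 := by
    rw [add_comm, log_div hs.ne' two_ne_zero]
  have e5 : log ((v + u) / (v - u)) = log (v + u) - log (v - u) := log_div hs.ne' hd.ne'
  rw [key, ← mul_pow, sqrt_sq (mul_pos hu hv).le, sqrt_sq hu.le, sqrt_sq hv.le, e1, e2, e3, e4, e5]
  have hne : v ^ 2 - u ^ 2 ≠ 0 := by linarith
  field_simp
  ring
end

section
/- Let σ ≥ −√2, set b = (2/3)·(√(σ² + 6) + σ/2), and let f(x) = (1/(2π))·√((b−x)/(x−σ))·(2x + b − σ) for x ∈ (σ, b]. Then ∫_σ^b ∫_σ^b log(1/|s−t|)·f(s)·f(t) ds dt + ∫_σ^b s²·f(s) ds = (1/108)·(81 + 72σ² − 2σ⁴ + (30σ + 2σ³)·√(6 + σ²) − 108·log((1/6)·(−σ + √(6 + σ²)))). In particular, for σ = 0 this value equals 3/4 + (1/2)·log 2 + (1/2)·log 3. -/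
/-- `f(x) = (1/(2π))·√((b−x)/(x−σ))·(2x + b − σ)`. -/
noncomputable def densG (σ b x : ℝ) : ℝ :=
  (1 / (2 * Real.pi)) * Real.sqrt ((b - x) / (x - σ)) * (2 * x + b - σ)

open MeasureTheory Set Real intervalIntegral

/-- `log (sin ((u + c) / 2))` is integrable on every interval. -/
lemma intervalIntegrable_log_sin_half_add (c p q : ℝ) :
    IntervalIntegrable (fun u => log (sin ((u + c) / 2))) volume p q := by
  have h : AnalyticOnNhd ℝ (fun u : ℝ => sin ((u + c) / 2)) univ := fun x _ => by fun_prop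
  exact (h.meromorphicOn.mono_set (subset_univ (uIcc p q))).intervalIntegrable_log

lemma intervalIntegrable_log_sin_half (p q : ℝ) :
    IntervalIntegrable (fun u => log (sin (u / 2))) volume p q := by
  simpa using intervalIntegrable_log_sin_half_add 0 p q

lemma intervalIntegrable_log_cos_sub_cos (φ p q : ℝ) :
    IntervalIntegrable (fun θ => log (cos θ - cos φ)) volume p q := by
  have h : AnalyticOnNhd ℝ (fun θ : ℝ => cos θ - cos φ) univ := fun x _ => by fun_prop
  exact (h.meromorphicOn.mono_set (subset_univ (uIcc p q))).intervalIntegrable_log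

lemma integral_neg_pi_pi_eq {g : ℝ → ℝ} (hg : ∀ p q, IntervalIntegrable g volume p q) :
    ∫ x in -π..π, g x = ∫ x in 0..π, (g x + g (-x)) := by
  have h : IntervalIntegrable (fun x => g (-x)) volume 0 π := by
    simpa using (hg 0 (-π)).comp_mul_left (c := -1)
  rw [integral_add (hg _ _) h, integral_comp_neg, neg_zero, add_comm,
    integral_add_adjacent_intervals (hg _ _) (hg _ _)]

lemma integral_neg_pi_pi_odd {g : ℝ → ℝ} (hg : ∀ x, g (-x) = -g x) :
    ∫ x in -π..π, g x = 0 := by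
  have h := integral_comp_neg (a := -π) (b := π) g
  simp only [hg, neg_neg, intervalIntegral.integral_neg] at h
  linarith

lemma log_sin_half_neg (u : ℝ) : log (sin (-u / 2)) = log (sin (u / 2)) := by
  rw [neg_div, sin_neg, log_neg_eq_log]

lemma integral_log_sin_half : ∫ u in -π..π, log (sin (u / 2)) = -(2 * π * log 2) := by
  have hper : Function.Periodic (fun u : ℝ => log (sin (u / 2))) (2 * π) := fun u => by
    have : (u + 2 * π) / 2 = u / 2 + π := by ring
    simp only [this, sin_add_pi, log_neg_eq_log]
  have h := hper.intervalIntegral_add_eq (-π) 0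
  rw [show -π + 2 * π = π by ring, zero_add] at h
  rw [h, integral_comp_div (fun u => log (sin u)) two_ne_zero, zero_div,
    mul_div_cancel_left₀ _ two_ne_zero, integral_log_sin_zero_pi, smul_eq_mul]
  ring

lemma hasDerivAt_log_sin_half {u : ℝ} (hu : sin (u / 2) ≠ 0) :
    HasDerivAt (fun u => log (sin (u / 2))) (cos (u / 2) / 2 / sin (u / 2)) u := by
  have := (((hasDerivAt_id u).div_const 2).sin).log hu
  simpa [div_eq_mul_inv] using this

lemma continuous_sin_mul_log_sin_half :
    Continuous fun u : ℝ => sin u * log (sin (u / 2)) := by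
  have h : (fun u : ℝ => sin u * log (sin (u / 2))) =
      fun u => 2 * cos (u / 2) * (sin (u / 2) * log (sin (u / 2))) := by
    ext u
    have : sin u = 2 * sin (u / 2) * cos (u / 2) := by rw [← sin_two_mul]; congr 1; ring
    rw [this]; ring
  rw [h]
  have := continuous_mul_log.comp (f := fun u : ℝ => sin (u / 2)) (by fun_prop)
  exact Continuous.mul (by fun_prop) this

lemma sin_half_ne_zero {u : ℝ} (hu : u ∈ Ioo (-π) π) (h0 : u ≠ 0) : sin (u / 2) ≠ 0 := by
  intro h
  have := (sin_eq_zero_iff_of_lt_of_lt (by linarith [hu.1, pi_pos]) (by linarith [hu.2, pi_pos])).1 h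
  exact h0 (by linarith)

lemma integral_cos_mul_log_sin_half :
    ∫ u in -π..π, cos u * log (sin (u / 2)) = -π := by
  have hI : IntervalIntegrable (fun u => cos u * log (sin (u / 2))) volume (-π) π :=
    (intervalIntegrable_log_sin_half _ _).continuousOn_mul continuous_cos.continuousOn
  have hc : IntervalIntegrable (fun u => (1 + cos u) / 2) volume (-π) π :=
    Continuous.intervalIntegrable (by fun_prop) _ _
  have h := integral_eq_of_hasDerivAt_off_countable_of_le
    (fun u => sin u * log (sin (u / 2)))
    (fun u => cos u * log (sin (u / 2)) + (1 + cos u) / 2)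
    (a := -π) (b := π) (by linarith [pi_pos]) (countable_singleton 0)
    continuous_sin_mul_log_sin_half.continuousOn
    (fun u hu => by
      have hs := sin_half_ne_zero hu.1 hu.2
      refine ((hasDerivAt_sin u).mul (hasDerivAt_log_sin_half hs)).congr_deriv ?_
      have h1 : sin u = 2 * sin (u / 2) * cos (u / 2) := by rw [← sin_two_mul]; congr 1; ring
      have h2 : cos u = 2 * cos (u / 2) ^ 2 - 1 := by rw [← cos_two_mul]; congr 1; ring
      rw [h1, h2]; field_simp; ring)
    (hI.add hc)
  rw [integral_add hI hc] at h
  have h2 : ∫ u in -π..π, (1 + cos u) / 2 = π := by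
    simp
  rw [h2] at h
  simp only [sin_pi, sin_neg] at h
  linarith

lemma integral_cos_two_mul_mul_log_sin_half :
    ∫ u in -π..π, cos (2 * u) * log (sin (u / 2)) = -(π / 2) := by
  have hI : IntervalIntegrable (fun u => cos (2 * u) * log (sin (u / 2))) volume (-π) π :=
    (intervalIntegrable_log_sin_half _ _).continuousOn_mul (by fun_prop)
  have hc : IntervalIntegrable (fun u => (cos u + cos u ^ 2) / 2) volume (-π) π :=
    Continuous.intervalIntegrable (by fun_prop) _ _
  have h := integral_eq_of_hasDerivAt_off_countable_of_le
    (fun u => cos u * (sin u * log (sin (u / 2))))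
    (fun u => cos (2 * u) * log (sin (u / 2)) + (cos u + cos u ^ 2) / 2)
    (a := -π) (b := π) (by linarith [pi_pos]) (countable_singleton 0)
    (continuous_cos.mul continuous_sin_mul_log_sin_half).continuousOn
    (fun u hu => by
      have hs := sin_half_ne_zero hu.1 hu.2
      refine ((hasDerivAt_cos u).mul
        ((hasDerivAt_sin u).mul (hasDerivAt_log_sin_half hs))).congr_deriv ?_
      have h1 : sin u = 2 * sin (u / 2) * cos (u / 2) := by rw [← sin_two_mul]; congr 1; ring
      have h2 : cos u = 2 * cos (u / 2) ^ 2 - 1 := by rw [← cos_two_mul]; congr 1; ring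
      have h3 : cos (2 * u) = cos u ^ 2 - sin u ^ 2 := by rw [cos_two_mul']
      have h4 : sin u * (cos (u / 2) / 2 / sin (u / 2)) = (1 + cos u) / 2 := by
        rw [h1, h2]; field_simp; ring
      simp only [Pi.mul_apply]
      rw [h4, h3]; ring)
    (hI.add hc)
  rw [integral_add hI hc] at h
  have h2 : ∫ u in -π..π, (cos u + cos u ^ 2) / 2 = π / 2 := by
    rw [intervalIntegral.integral_div, integral_add (Continuous.intervalIntegrable (by fun_prop) _ _)
      (Continuous.intervalIntegrable (by fun_prop) _ _), integral_cos_sq]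
    simp
  rw [h2] at h
  simp only [sin_pi, sin_neg] at h
  linarith

lemma log_cos_sub_cos {θ φ : ℝ} (hθ : θ ∈ Ioo 0 π) (hφ : φ ∈ Ioo 0 π) (hne : θ ≠ φ) :
    log (cos θ - cos φ) = log 2 + log (sin ((θ + φ) / 2)) + log (sin ((-θ + φ) / 2)) := by
  have h1 : sin ((θ + φ) / 2) ≠ 0 :=
    (sin_pos_of_pos_of_lt_pi (by linarith [hθ.1, hφ.1]) (by linarith [hθ.2, hφ.2])).ne'
  have h2 : sin ((-θ + φ) / 2) ≠ 0 :=
    sin_half_ne_zero ⟨by linarith [hθ.2, hφ.1], by linarith [hθ.1, hφ.2]⟩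
      fun h => hne (by linarith)
  rw [cos_sub_cos, ← log_mul two_ne_zero h1, ← log_mul (mul_ne_zero two_ne_zero h1) h2]
  congr 1
  rw [show (-θ + φ) / 2 = -((θ - φ) / 2) by ring, sin_neg]
  ring

/-- The logarithmic potential of an even trigonometric polynomial of degree two. -/
lemma integral_log_cos_sub_cos_mul (A B C : ℝ) {φ : ℝ} (hφ : φ ∈ Ioo 0 π) :
    ∫ θ in Ioo 0 π, log (cos θ - cos φ) * (A + B * cos θ + C * cos (2 * θ)) =
      -(π * (A * log 2 + B * cos φ + C / 2 * cos (2 * φ))) := by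
  set w : ℝ → ℝ := fun θ => A + B * cos θ + C * cos (2 * θ) with hw
  have hwc : Continuous w := by fun_prop
  have hsplit : ∫ θ in Ioo 0 π, log (cos θ - cos φ) * w θ =
      ∫ θ in 0..π, (log 2 * w θ +
        (log (sin ((θ + φ) / 2)) * w θ + log (sin ((-θ + φ) / 2)) * w (-θ))) := by
    rw [integral_of_le pi_pos.le, integral_Ioc_eq_integral_Ioo]
    refine integral_congr_ae ?_
    have hne : ∀ᵐ θ ∂(volume.restrict (Ioo 0 π)), θ ≠ φ :=
      ae_restrict_of_ae (Measure.ae_ne volume φ)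
    filter_upwards [ae_restrict_mem measurableSet_Ioo, hne] with θ hθ hn
    have : w (-θ) = w θ := by simp [hw]
    rw [log_cos_sub_cos hθ hφ hn, this]
    ring
  have hg : ∀ p q, IntervalIntegrable (fun θ => log (sin ((θ + φ) / 2)) * w θ) volume p q :=
    fun p q => (intervalIntegrable_log_sin_half_add φ p q).mul_continuousOn hwc.continuousOn
  have hg' : IntervalIntegrable (fun θ => log (sin ((-θ + φ) / 2)) * w (-θ)) volume 0 π := by
    simpa using (hg 0 (-π)).comp_mul_left (c := -1)
  have hper : Function.Periodic (fun u : ℝ => log (sin (u / 2)) * w (u - φ)) (2 * π) := fun u => by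
    have h1 : (u + 2 * π) / 2 = u / 2 + π := by ring
    have h2 : u + 2 * π - φ = u - φ + 2 * π := by ring
    have h3 : 2 * (u - φ + 2 * π) = 2 * (u - φ) + 2 * π + 2 * π := by ring
    simp only [hw, h1, h2, h3, sin_add_pi, log_neg_eq_log, cos_add_two_pi]
  have hshift : ∫ θ in -π..π, log (sin ((θ + φ) / 2)) * w θ =
      ∫ u in -π..π, log (sin (u / 2)) * w (u - φ) := by
    have h1 := integral_comp_add_right (a := -π) (b := π)
      (fun u => log (sin (u / 2)) * w (u - φ)) φ
    have h2 := hper.intervalIntegral_add_eq (-π + φ) (-π)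
    rw [show -π + φ + 2 * π = π + φ by ring, show -π + 2 * π = π by ring] at h2
    simp only [add_sub_cancel_right] at h1
    rw [h1, h2]
  have hL := intervalIntegrable_log_sin_half (-π) π
  have hexp : ∫ u in -π..π, log (sin (u / 2)) * w (u - φ) =
      A * -(2 * π * log 2) + B * cos φ * -π + C * cos (2 * φ) * -(π / 2) := by
    have i1 : IntervalIntegrable (fun u => cos u * log (sin (u / 2))) volume (-π) π :=
      hL.continuousOn_mul (by fun_prop)
    have i2 : IntervalIntegrable (fun u => cos (2 * u) * log (sin (u / 2))) volume (-π) π :=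
      hL.continuousOn_mul (by fun_prop)
    have i3 : IntervalIntegrable (fun u => (B * sin φ * sin u + C * sin (2 * φ) * sin (2 * u)) *
        log (sin (u / 2))) volume (-π) π :=
      hL.continuousOn_mul (by fun_prop)
    have h3 : ∫ u in -π..π, (B * sin φ * sin u + C * sin (2 * φ) * sin (2 * u)) *
        log (sin (u / 2)) = 0 := by
      refine integral_neg_pi_pi_odd fun u => ?_
      rw [log_sin_half_neg, mul_neg, sin_neg, sin_neg]
      ring
    have hexpand : ∀ u, log (sin (u / 2)) * w (u - φ) =
        A * log (sin (u / 2)) + B * cos φ * (cos u * log (sin (u / 2))) +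
          C * cos (2 * φ) * (cos (2 * u) * log (sin (u / 2))) +
          (B * sin φ * sin u + C * sin (2 * φ) * sin (2 * u)) * log (sin (u / 2)) := fun u => by
      simp only [hw, mul_sub, cos_sub]
      ring
    simp only [hexpand]
    rw [integral_add (((hL.const_mul _).add (i1.const_mul _)).add (i2.const_mul _)) i3,
      integral_add ((hL.const_mul _).add (i1.const_mul _)) (i2.const_mul _),
      integral_add (hL.const_mul _) (i1.const_mul _), intervalIntegral.integral_const_mul,
      intervalIntegral.integral_const_mul, intervalIntegral.integral_const_mul,
      integral_log_sin_half, integral_cos_mul_log_sin_half,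
      integral_cos_two_mul_mul_log_sin_half, h3, add_zero]
  rw [hsplit, integral_add (Continuous.intervalIntegrable (by fun_prop) _ _) (hg 0 π |>.add hg'),
    ← integral_neg_pi_pi_eq hg, hshift, hexp]
  have hw0 : ∫ θ in 0..π, log 2 * w θ = log 2 * (π * A) := by
    rw [intervalIntegral.integral_const_mul]
    congr 1
    simp only [hw]
    rw [integral_add (Continuous.intervalIntegrable (by fun_prop) _ _)
      (Continuous.intervalIntegrable (by fun_prop) _ _),
      integral_add (Continuous.intervalIntegrable (by fun_prop) _ _)
      (Continuous.intervalIntegrable (by fun_prop) _ _)]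
    simp
  rw [hw0]
  ring

/-- The pullback of `densG σ b x dx` under `x = (b + σ) / 2 + (b - σ) / 2 * cos θ`. -/
noncomputable def densAngle (σ b θ : ℝ) : ℝ :=
  (b - σ) / 2 / π * (3 * b + σ) / 4 + -((b - σ) / 2 / π * ((b + σ) / 2)) * cos θ +
    -((b - σ) / 2 / π * ((b - σ) / 4)) * cos (2 * θ)

lemma image_angle {σ b : ℝ} (h : σ < b) :
    (fun θ => (b + σ) / 2 + (b - σ) / 2 * cos θ) '' Ioo 0 π = Ioo σ b := by
  ext x
  constructor
  · rintro ⟨θ, hθ, rfl⟩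
    have h1 : cos θ < 1 := by
      simpa using strictAntiOn_cos ⟨le_rfl, pi_pos.le⟩ (Ioo_subset_Icc_self hθ) hθ.1
    have h2 : -1 < cos θ := by
      simpa using strictAntiOn_cos (Ioo_subset_Icc_self hθ) ⟨pi_pos.le, le_rfl⟩ hθ.2
    constructor <;> dsimp only <;> nlinarith
  · intro hx
    have hr : 0 < (b - σ) / 2 := by linarith
    refine ⟨arccos ((x - (b + σ) / 2) / ((b - σ) / 2)), ⟨?_, ?_⟩, ?_⟩
    · rw [arccos_pos, div_lt_one hr]; linarith [hx.2]
    · refine lt_of_le_of_ne (arccos_le_pi _) fun h => ?_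
      rw [arccos_eq_pi, div_le_iff₀ hr] at h; linarith [hx.1]
    · dsimp only
      rw [cos_arccos, mul_div_cancel₀ _ hr.ne']
      · ring
      · rw [le_div_iff₀ hr]; linarith [hx.1]
      · rw [div_le_one hr]; linarith [hx.2]

lemma hasDerivWithinAt_angle (σ b θ : ℝ) (s : Set ℝ) :
    HasDerivWithinAt (fun θ => (b + σ) / 2 + (b - σ) / 2 * cos θ) (-((b - σ) / 2 * sin θ)) s θ := by
  have := (((hasDerivAt_cos θ).const_mul ((b - σ) / 2)).const_add ((b + σ) / 2)).hasDerivWithinAt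
    (s := s)
  simpa using this

lemma injOn_angle {σ b : ℝ} (h : σ < b) :
    InjOn (fun θ => (b + σ) / 2 + (b - σ) / 2 * cos θ) (Ioo 0 π) := fun x hx y hy hxy => by
  have hr : (b - σ) / 2 ≠ 0 := by linarith
  exact injOn_cos (Ioo_subset_Icc_self hx) (Ioo_subset_Icc_self hy)
    (mul_left_cancel₀ hr (add_left_cancel hxy))

lemma abs_deriv_mul_densG {σ b θ : ℝ} (h : σ < b) (hθ : θ ∈ Ioo 0 π) (y : ℝ) :
    |-((b - σ) / 2 * sin θ)| • (y * densG σ b ((b + σ) / 2 + (b - σ) / 2 * cos θ)) =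
      y * densAngle σ b θ := by
  have hr : 0 < b - σ := by linarith
  have hs : 0 < sin θ := sin_pos_of_mem_Ioo hθ
  have h1 : cos θ < 1 := by
    simpa using strictAntiOn_cos ⟨le_rfl, pi_pos.le⟩ (Ioo_subset_Icc_self hθ) hθ.1
  have h2 : -1 < cos θ := by
    simpa using strictAntiOn_cos (Ioo_subset_Icc_self hθ) ⟨pi_pos.le, le_rfl⟩ hθ.2
  have h3 : 0 < 1 + cos θ := by linarith
  have hsq : √((b - ((b + σ) / 2 + (b - σ) / 2 * cos θ)) /
      ((b + σ) / 2 + (b - σ) / 2 * cos θ - σ)) = (1 - cos θ) / sin θ := by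
    have hd : (b + σ) / 2 + (b - σ) / 2 * cos θ - σ = (b - σ) / 2 * (1 + cos θ) := by ring
    have hn : b - ((b + σ) / 2 + (b - σ) / 2 * cos θ) = (b - σ) / 2 * (1 - cos θ) := by ring
    rw [hd, hn, mul_div_mul_left _ _ (by positivity)]
    rw [sqrt_eq_iff_mul_self_eq (div_nonneg (by linarith) h3.le) (div_nonneg (by linarith) hs.le)]
    rw [div_mul_div_comm, div_eq_div_iff h3.ne' (by positivity), ← sq (sin θ), sin_sq]
    ring
  rw [abs_neg, abs_of_pos (by positivity), densG, hsq, densAngle, cos_two_mul, smul_eq_mul]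
  field_simp
  ring

lemma integral_mul_densG {σ b : ℝ} (h : σ < b) (g : ℝ → ℝ) :
    ∫ x in Ioo σ b, g x * densG σ b x =
      ∫ θ in Ioo 0 π, g ((b + σ) / 2 + (b - σ) / 2 * cos θ) * densAngle σ b θ := by
  rw [← image_angle h, integral_image_eq_integral_abs_deriv_smul measurableSet_Ioo
    (fun θ _ => hasDerivWithinAt_angle σ b θ _) (injOn_angle h)]
  exact setIntegral_congr_fun measurableSet_Ioo fun θ hθ => abs_deriv_mul_densG h hθ _

lemma integrableOn_mul_densG {σ b : ℝ} (h : σ < b) (g : ℝ → ℝ) :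
    IntegrableOn (fun x => g x * densG σ b x) (Ioo σ b) ↔
      IntegrableOn (fun θ => g ((b + σ) / 2 + (b - σ) / 2 * cos θ) * densAngle σ b θ) (Ioo 0 π) := by
  rw [← image_angle h, integrableOn_image_iff_integrableOn_abs_deriv_smul measurableSet_Ioo
    (fun θ _ => hasDerivWithinAt_angle σ b θ _) (injOn_angle h)]
  exact integrableOn_congr_fun (fun θ hθ => abs_deriv_mul_densG h hθ _) measurableSet_Ioo

lemma continuous_densAngle (σ b : ℝ) : Continuous (densAngle σ b) := by
  unfold densAngle; fun_prop

lemma Continuous.integrableOn_mul_densG {σ b : ℝ} (h : σ < b) {g : ℝ → ℝ} (hg : Continuous g) :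
    IntegrableOn (fun x => g x * densG σ b x) (Ioo σ b) := by
  rw [_root_.integrableOn_mul_densG h]
  have hc : Continuous fun θ => g ((b + σ) / 2 + (b - σ) / 2 * cos θ) * densAngle σ b θ :=
    Continuous.mul (by fun_prop) (continuous_densAngle σ b)
  exact (hc.integrableOn_Icc (a := 0) (b := π)).mono_set Ioo_subset_Icc_self

lemma integrableOn_densG {σ b : ℝ} (h : σ < b) : IntegrableOn (densG σ b) (Ioo σ b) := by
  simpa using (continuous_const (y := (1 : ℝ))).integrableOn_mul_densG h

lemma integral_cos_poly (p q r s t : ℝ) :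
    ∫ θ in Ioo 0 π, (p + q * cos θ + r * cos θ ^ 2 + s * cos θ ^ 3 + t * cos θ ^ 4) =
      π * (p + r / 2 + 3 * t / 8) := by
  rw [← integral_Ioc_eq_integral_Ioo, ← integral_of_le pi_pos.le]
  have h4 : ∫ θ in 0..π, cos θ ^ 4 = 3 * π / 8 := by
    rw [integral_cos_pow, integral_cos_sq]; simp; ring
  have h3 : ∫ θ in 0..π, cos θ ^ 3 = 0 := by
    rw [integral_cos_pow]; simp
  have h2 : ∫ θ in 0..π, cos θ ^ 2 = π / 2 := by
    rw [integral_cos_sq]; simp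
  have i (n : ℕ) (k : ℝ) : IntervalIntegrable (fun θ => k * cos θ ^ n) volume 0 π :=
    Continuous.intervalIntegrable (by fun_prop) _ _
  have i1 : IntervalIntegrable (fun θ => q * cos θ) volume 0 π :=
    Continuous.intervalIntegrable (by fun_prop) _ _
  have i0 : IntervalIntegrable (fun _ => p) volume 0 π := intervalIntegrable_const
  rw [integral_add (((i0.add i1).add (i 2 r)).add (i 3 s)) (i 4 t),
    integral_add ((i0.add i1).add (i 2 r)) (i 3 s), integral_add (i0.add i1) (i 2 r),
    integral_add i0 i1]
  simp only [intervalIntegral.integral_const_mul, h2, h3, h4, integral_cos,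
    intervalIntegral.integral_const, sin_pi, sin_zero, smul_eq_mul]
  ring

lemma integral_densG {σ b : ℝ} (h : σ < b) :
    ∫ x in Ioo σ b, densG σ b x = (b - σ) / 2 * (3 * b + σ) / 4 := by
  have h1 := integral_mul_densG h fun _ => 1
  simp only [one_mul] at h1
  rw [h1]
  have h2 (θ : ℝ) : densAngle σ b θ =
      ((b - σ) / 2 / π * (3 * b + σ) / 4 + (b - σ) / 2 / π * ((b - σ) / 4)) +
      -((b - σ) / 2 / π * ((b + σ) / 2)) * cos θ +
      -((b - σ) / 2 / π * ((b - σ) / 2)) * cos θ ^ 2 + 0 * cos θ ^ 3 + 0 * cos θ ^ 4 := by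
    rw [densAngle, cos_two_mul]; ring
  simp only [h2]
  rw [integral_cos_poly]
  field_simp
  ring

lemma integral_sq_mul_densG {σ b : ℝ} (h : σ < b) :
    ∫ x in Ioo σ b, x ^ 2 * densG σ b x =
      (b - σ) / 2 * ((((b + σ) / 2) ^ 2 + ((b - σ) / 2) ^ 2 / 2) * ((3 * b + σ) / 4) -
        ((b + σ) / 2) ^ 2 * ((b - σ) / 2) - ((b - σ) / 2) ^ 3 / 8) := by
  rw [integral_mul_densG h]
  set r := (b - σ) / 2 with hr
  set c := (b + σ) / 2 with hc
  have h2 (θ : ℝ) : (c + r * cos θ) ^ 2 * densAngle σ b θ =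
      c ^ 2 * (r / π * b) + (2 * c * r * (r / π * b) - c ^ 2 * (r / π * c)) * cos θ +
      (r ^ 2 * (r / π * b) - 2 * c * r * (r / π * c) - c ^ 2 * (r / π * r)) * cos θ ^ 2 +
      (-r ^ 2 * (r / π * c) - 2 * c * r * (r / π * r)) * cos θ ^ 3 +
      (-r ^ 2 * (r / π * r)) * cos θ ^ 4 := by
    rw [densAngle, cos_two_mul, hr, hc]; ring
  simp only [h2]
  rw [integral_cos_poly]
  have : b = c + r := by rw [hr, hc]; ring
  have h3 : 3 * b + σ = 4 * c + 2 * r := by rw [hr, hc]; ring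
  rw [h3, this]
  field_simp
  ring

lemma log_one_div_abs_angle {r c θ φ : ℝ} (hr : 0 < r) (hθ : θ ∈ Ioo 0 π) (hφ : φ ∈ Ioo 0 π)
    (hne : θ ≠ φ) :
    log (1 / |c + r * cos φ - (c + r * cos θ)|) = -log r - log (cos θ - cos φ) := by
  have hc : cos θ - cos φ ≠ 0 := fun h =>
    hne (injOn_cos (Ioo_subset_Icc_self hθ) (Ioo_subset_Icc_self hφ) (sub_eq_zero.1 h))
  rw [one_div, log_inv, log_abs,
    show c + r * cos φ - (c + r * cos θ) = -(r * (cos θ - cos φ)) by ring, log_neg_eq_log,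
    log_mul hr.ne' hc]
  ring

lemma ae_log_one_div_abs_angle {σ b φ : ℝ} (h : σ < b) (hφ : φ ∈ Ioo 0 π) :
    (fun θ => log (1 / |(b + σ) / 2 + (b - σ) / 2 * cos φ -
        ((b + σ) / 2 + (b - σ) / 2 * cos θ)|) * densAngle σ b θ) =ᵐ[volume.restrict (Ioo 0 π)]
      fun θ => -log ((b - σ) / 2) * densAngle σ b θ - log (cos θ - cos φ) * densAngle σ b θ := by
  filter_upwards [ae_restrict_mem measurableSet_Ioo,
    ae_restrict_of_ae (Measure.ae_ne volume φ)] with θ hθ hn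
  rw [log_one_div_abs_angle (by linarith) hθ hφ hn]
  ring

lemma integrableOn_densAngle (σ b : ℝ) : IntegrableOn (densAngle σ b) (Ioo 0 π) :=
  ((continuous_densAngle σ b).integrableOn_Icc (a := 0) (b := π)).mono_set Ioo_subset_Icc_self

lemma integrableOn_log_cos_sub_cos_mul_densAngle (σ b φ : ℝ) :
    IntegrableOn (fun θ => log (cos θ - cos φ) * densAngle σ b θ) (Ioo 0 π) := by
  have := (intervalIntegrable_log_cos_sub_cos φ 0 π).mul_continuousOn
    (continuous_densAngle σ b).continuousOn
  exact ((intervalIntegrable_iff_integrableOn_Ioo_of_le pi_pos.le).1 this)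

lemma integrableOn_log_one_div_abs_mul_densG {σ b s : ℝ} (hs : s ∈ Ioo σ b) :
    IntegrableOn (fun t => log (1 / |s - t|) * densG σ b t) (Ioo σ b) := by
  have h := hs.1.trans hs.2
  rw [integrableOn_mul_densG h]
  obtain ⟨φ, hφ, rfl⟩ := (image_angle h).symm ▸ hs
  exact (((integrableOn_densAngle σ b).const_mul _).sub
    (integrableOn_log_cos_sub_cos_mul_densAngle σ b φ)).congr (ae_log_one_div_abs_angle h hφ).symm

/-- The logarithmic potential of `densG σ b` is quadratic on its support. -/
lemma integral_log_one_div_abs_mul_densG {σ b s : ℝ} (hs : s ∈ Ioo σ b)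
    (hm : (b - σ) / 2 * (3 * b + σ) / 4 = 1) :
    ∫ t in Ioo σ b, log (1 / |s - t|) * densG σ b t =
      -log ((b - σ) / 4) + (((b + σ) / 2) ^ 2 / 2 + ((b - σ) / 2) ^ 2 / 4) - s ^ 2 / 2 := by
  have h := hs.1.trans hs.2
  have hmass := integral_densG h
  have h1 := integral_mul_densG h fun _ => 1
  simp only [one_mul] at h1
  rw [integral_mul_densG h]
  obtain ⟨φ, hφ, rfl⟩ := (image_angle h).symm ▸ hs
  dsimp only
  rw [integral_congr_ae (ae_log_one_div_abs_angle h hφ), MeasureTheory.integral_sub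
    ((integrableOn_densAngle σ b).const_mul _)
    (integrableOn_log_cos_sub_cos_mul_densAngle σ b φ), MeasureTheory.integral_const_mul, ← h1,
    hmass, hm]
  simp only [densAngle]
  rw [integral_log_cos_sub_cos_mul _ _ _ hφ, cos_two_mul]
  have hA : π * ((b - σ) / 2 / π * (3 * b + σ) / 4 * log 2) = log 2 := by
    calc _ = ((b - σ) / 2 * (3 * b + σ) / 4) * log 2 := by field_simp
      _ = _ := by rw [hm, one_mul]
  have hl : log ((b - σ) / 4) = log ((b - σ) / 2) - log 2 := by
    rw [← log_div (by linarith) two_ne_zero]; congr 1; ring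
  rw [mul_add, mul_add, hA, hl]
  field_simp
  ring

lemma measurable_densG (σ b : ℝ) : Measurable (densG σ b) := by
  unfold densG; fun_prop

lemma densG_nonneg {σ b x : ℝ} (hσb : 0 ≤ σ + b) (hx : σ ≤ x) : 0 ≤ densG σ b x := by
  unfold densG
  have : 0 ≤ 2 * x + b - σ := by linarith
  positivity

lemma integrable_log_kernel_densG {σ b : ℝ} (hσb : 0 ≤ σ + b) (h : σ < b)
    (hm : (b - σ) / 2 * (3 * b + σ) / 4 = 1) :
    Integrable (fun p : ℝ × ℝ => log (1 / |p.1 - p.2|) * densG σ b p.1 * densG σ b p.2)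
      ((volume.restrict (Ioo σ b)).prod (volume.restrict (Ioo σ b))) := by
  set ν := volume.restrict (Ioo σ b)
  set K := |log (b - σ)|
  have hf : Integrable (densG σ b) ν := integrableOn_densG h
  have hmeas := measurable_densG σ b
  have hK : ∀ s ∈ Ioo σ b, ∀ t ∈ Ioo σ b, 0 ≤ log (1 / |s - t|) + K := fun s hs t ht => by
    rcases eq_or_ne s t with rfl | hne
    · simp [K]
    · have h1 : |s - t| ≤ b - σ := abs_le.2 ⟨by linarith [hs.1, ht.2], by linarith [hs.2, ht.1]⟩
      have h2 := log_le_log (abs_pos.2 (sub_ne_zero.2 hne)) h1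
      rw [one_div, log_inv]
      linarith [le_abs_self (log (b - σ))]
  have hg : Integrable (fun p : ℝ × ℝ =>
      (log (1 / |p.1 - p.2|) + K) * densG σ b p.1 * densG σ b p.2) (ν.prod ν) := by
    have hgm : Measurable (fun p : ℝ × ℝ =>
        (log (1 / |p.1 - p.2|) + K) * densG σ b p.1 * densG σ b p.2) := by fun_prop
    have hexp (s t : ℝ) : (log (1 / |s - t|) + K) * densG σ b s * densG σ b t =
        densG σ b s * (log (1 / |s - t|) * densG σ b t + K * densG σ b t) := by ring
    rw [integrable_prod_iff hgm.aestronglyMeasurable]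
    constructor
    · filter_upwards [ae_restrict_mem measurableSet_Ioo] with s hs
      simp only [hexp]
      exact ((integrableOn_log_one_div_abs_mul_densG hs).add (hf.const_mul K)).const_mul _
    · have hc : Continuous fun s : ℝ => -log ((b - σ) / 4) +
          (((b + σ) / 2) ^ 2 / 2 + ((b - σ) / 2) ^ 2 / 4) - s ^ 2 / 2 + K := by fun_prop
      refine (hc.integrableOn_mul_densG h).congr ?_
      filter_upwards [ae_restrict_mem measurableSet_Ioo] with s hs
      have hnorm : ∫ t, ‖(log (1 / |s - t|) + K) * densG σ b s * densG σ b t‖ ∂ν =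
          ∫ t, densG σ b s * (log (1 / |s - t|) * densG σ b t + K * densG σ b t) ∂ν := by
        refine integral_congr_ae ?_
        filter_upwards [ae_restrict_mem measurableSet_Ioo] with t ht
        rw [Real.norm_of_nonneg (mul_nonneg (mul_nonneg (hK s hs t ht)
          (densG_nonneg hσb hs.1.le)) (densG_nonneg hσb ht.1.le)), hexp]
      rw [hnorm, MeasureTheory.integral_const_mul, MeasureTheory.integral_add
        (integrableOn_log_one_div_abs_mul_densG hs) (hf.const_mul K),
        MeasureTheory.integral_const_mul, integral_log_one_div_abs_mul_densG hs hm,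
        integral_densG h, hm]
      ring
  refine (hg.sub ((hf.mul_prod hf).const_mul K)).congr (Filter.Eventually.of_forall fun p => ?_)
  simp only [Pi.sub_apply]
  ring

lemma integral_log_kernel_densG {σ b : ℝ} (hσb : 0 ≤ σ + b) (h : σ < b)
    (hm : (b - σ) / 2 * (3 * b + σ) / 4 = 1) :
    ∫ p in Ioo σ b ×ˢ Ioo σ b, log (1 / |p.1 - p.2|) * densG σ b p.1 * densG σ b p.2 =
      -log ((b - σ) / 4) + (((b + σ) / 2) ^ 2 / 2 + ((b - σ) / 2) ^ 2 / 4) -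
        (∫ s in Ioo σ b, s ^ 2 * densG σ b s) / 2 := by
  have hsq : IntegrableOn (fun s => s ^ 2 * densG σ b s) (Ioo σ b) :=
    (continuous_pow 2).integrableOn_mul_densG h
  rw [Measure.volume_eq_prod, ← Measure.prod_restrict,
    integral_prod _ (integrable_log_kernel_densG hσb h hm)]
  have hinner : ∀ s ∈ Ioo σ b,
      ∫ t in Ioo σ b, log (1 / |s - t|) * densG σ b s * densG σ b t =
      (-log ((b - σ) / 4) + (((b + σ) / 2) ^ 2 / 2 + ((b - σ) / 2) ^ 2 / 4)) * densG σ b s -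
        1 / 2 * (s ^ 2 * densG σ b s) := fun s hs => by
    have (t : ℝ) : log (1 / |s - t|) * densG σ b s * densG σ b t =
        densG σ b s * (log (1 / |s - t|) * densG σ b t) := by ring
    simp only [this]
    rw [MeasureTheory.integral_const_mul, integral_log_one_div_abs_mul_densG hs hm]
    ring
  rw [setIntegral_congr_fun measurableSet_Ioo hinner, MeasureTheory.integral_sub
    ((integrableOn_densG h).const_mul _) (hsq.const_mul _), MeasureTheory.integral_const_mul,
    MeasureTheory.integral_const_mul, integral_densG h, hm]
  ring

/-- The equilibrium energy for `σ ≥ −√2` and `b = (2/3)(√(σ²+6) + σ/2)`: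
`∫∫ log(1/|s−t|) f(s) f(t) ds dt + ∫ s² f(s) ds` equals the explicit value; in
particular, for `σ = 0` it equals `3/4 + (1/2) log 2 + (1/2) log 3`. -/
theorem energy_value (σ b : ℝ) (hσ : -Real.sqrt 2 ≤ σ)
    (hb : b = (2 / 3) * (Real.sqrt (σ ^ 2 + 6) + σ / 2)) :
    ((∫ p in (Set.Ioo σ b) ×ˢ (Set.Ioo σ b),
          Real.log (1 / |p.1 - p.2|) * densG σ b p.1 * densG σ b p.2) +
        ∫ s in Set.Ioo σ b, s ^ 2 * densG σ b s) =
      (1 / 108) *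
        (81 + 72 * σ ^ 2 - 2 * σ ^ 4 + (30 * σ + 2 * σ ^ 3) * Real.sqrt (6 + σ ^ 2) -
          108 * Real.log ((1 / 6) * (-σ + Real.sqrt (6 + σ ^ 2)))) ∧
      (σ = 0 →
        (1 / 108) *
            (81 + 72 * σ ^ 2 - 2 * σ ^ 4 + (30 * σ + 2 * σ ^ 3) * Real.sqrt (6 + σ ^ 2) -
              108 * Real.log ((1 / 6) * (-σ + Real.sqrt (6 + σ ^ 2)))) =
          3 / 4 + (1 / 2) * Real.log 2 + (1 / 2) * Real.log 3) := by
  set S := √(σ ^ 2 + 6) with hS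
  have hS2 : S ^ 2 = σ ^ 2 + 6 := sq_sqrt (by positivity)
  have hS0 : 0 ≤ S := sqrt_nonneg _
  have hS' : √(6 + σ ^ 2) = S := by rw [hS, add_comm]
  have hlt : σ < S := by nlinarith
  have h2σ : -(2 * σ) ≤ S := by
    by_contra! hcon
    have h2 : √2 ^ 2 = 2 := sq_sqrt (by norm_num)
    nlinarith [sqrt_nonneg (2 : ℝ)]
  have hbσ : b - σ = 2 * (S - σ) / 3 := by rw [hb]; ring
  have h : σ < b := by linarith
  have hm : (b - σ) / 2 * (3 * b + σ) / 4 = 1 := by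
    rw [hbσ, hb]; linear_combination (1 / 6) * hS2
  constructor
  · rw [integral_log_kernel_densG (by rw [hb]; linarith) h hm, integral_sq_mul_densG h, hS', hbσ,
      show 2 * (S - σ) / 3 / 4 = 1 / 6 * (-σ + S) by ring, hb]
    generalize log (1 / 6 * (-σ + S)) = l
    have hS3 : S ^ 3 = (σ ^ 2 + 6) * S := by rw [← hS2]; ring
    have hS4 : S ^ 4 = (σ ^ 2 + 6) ^ 2 := by rw [← hS2]; ring
    ring_nf
    rw [hS4, hS3, hS2]
    ring
  · rintro rfl
    have h6 : S = √6 := by rw [hS]; norm_num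
    have hl : log (1 / 6 * √6) = -(log 2 + log 3) / 2 := by
      rw [one_div, log_mul (by norm_num) (by positivity), log_inv, log_sqrt (by norm_num),
        show (6 : ℝ) = 2 * 3 by norm_num, log_mul (by norm_num) (by norm_num)]
      ring
    rw [hS', h6, neg_zero, zero_add, hl]
    ring
end

section
/- Let β > 0. For each n ≥ 1 set Z_n⁰ = ∫_{[0,∞)^n} exp(−(nβ/2)·Σᵢ xᵢ²)·∏_{i<j} |xᵢ − xⱼ|^β dx and Z_n = ∫_{ℝ^n} exp(−(nβ/2)·Σᵢ xᵢ²)·∏_{i<j} |xᵢ − xⱼ|^β dx. Then lim_{n→∞} (1/n²)·log(Z_n⁰ / Z_n) = −(β/4)·log 3. -/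
open Filter Topology

/-- `Z_n⁰ = ∫_{[0,∞)^n} exp(−(nβ/2) Σ xᵢ²) ∏_{i<j} |xᵢ−xⱼ|^β dx`. -/
noncomputable def Zplus (β : ℝ) (n : ℕ) : ℝ :=
  ∫ x in {x : Fin n → ℝ | ∀ i, 0 ≤ x i},
    Real.exp (-(n * β / 2) * ∑ i, x i ^ 2) *
      ∏ i, ∏ j ∈ Finset.Ioi i, |x i - x j| ^ β

/-- `Z_n = ∫_{ℝ^n} exp(−(nβ/2) Σ xᵢ²) ∏_{i<j} |xᵢ−xⱼ|^β dx`. -/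
noncomputable def Ztot (β : ℝ) (n : ℕ) : ℝ :=
  ∫ x : Fin n → ℝ,
    Real.exp (-(n * β / 2) * ∑ i, x i ^ 2) *
      ∏ i, ∏ j ∈ Finset.Ioi i, |x i - x j| ^ β

/-- The Green function of `ℂ ∖ [-1, 1]` with pole at infinity, on the real line. -/
noncomputable def intervalGreen (x : ℝ) : ℝ := Real.arcosh (max 1 |x|)

lemma intervalGreen_nonneg (x : ℝ) : 0 ≤ intervalGreen x :=
  Real.arcosh_nonneg (le_max_left _ _)

lemma cosh_intervalGreen (x : ℝ) : Real.cosh (intervalGreen x) = max 1 |x| :=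
  Real.cosh_arcosh (le_max_left _ _)

lemma intervalGreen_of_abs_le_one {x : ℝ} (hx : |x| ≤ 1) : intervalGreen x = 0 := by
  simp [intervalGreen, max_eq_left hx]

lemma intervalGreen_mono {x y : ℝ} (h : |x| ≤ max 1 |y|) : intervalGreen x ≤ intervalGreen y := by
  unfold intervalGreen
  rw [Real.arcosh_le_arcosh (by positivity) (by positivity)]
  exact max_le (le_max_left _ _) h

lemma abs_eval_T_le_exp (m : ℕ) (x : ℝ) :
    |(Polynomial.Chebyshev.T ℝ m).eval x| ≤ Real.exp (m * intervalGreen x) := by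
  have key : ∀ y : ℝ, 0 ≤ y → |(Polynomial.Chebyshev.T ℝ m).eval y| ≤
      Real.exp (m * intervalGreen y) := by
    intro y hy
    rcases le_total y 1 with h | h
    · refine (Polynomial.Chebyshev.abs_eval_T_real_le_one m (abs_le.2 ⟨by linarith, h⟩)).trans ?_
      exact Real.one_le_exp (mul_nonneg (Nat.cast_nonneg _) (intervalGreen_nonneg _))
    · have h1 : Real.cosh (intervalGreen y) = y := by
        rw [cosh_intervalGreen, abs_of_nonneg hy, max_eq_right h]
      conv_lhs => rw [← h1]
      rw [Polynomial.Chebyshev.T_real_cosh, abs_of_pos (Real.cosh_pos _), Real.cosh_eq]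
      have h2 : 0 ≤ ((m : ℕ) : ℝ) * intervalGreen y :=
        mul_nonneg (Nat.cast_nonneg _) (intervalGreen_nonneg _)
      have h3 : Real.exp (-(m * intervalGreen y)) ≤ Real.exp (m * intervalGreen y) :=
        Real.exp_le_exp.2 (by linarith)
      push_cast
      linarith
  rcases le_total 0 x with h | h
  · exact key x h
  · have h1 := key (-x) (by linarith)
    rw [Polynomial.Chebyshev.T_eval_neg, abs_mul] at h1
    have h2 : intervalGreen (-x) = intervalGreen x := by simp [intervalGreen]
    rw [h2] at h1
    refine le_trans (le_of_eq ?_) h1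
    have : |(((Int.negOnePow (m : ℤ) : ℤˣ) : ℤ) : ℝ)| = 1 := by
      rcases Int.units_eq_one_or (Int.negOnePow (m : ℤ)) with h | h <;> simp [h]
    rw [this, one_mul]

/-- The Chebyshev polynomial of the interval `[r (e - 1), r (e + 1)]`, normalized to be monic. -/
noncomputable def monicChebyshev (e r : ℝ) (m : ℕ) : Polynomial ℝ :=
  if m = 0 then 1 else
    Polynomial.C (2 * (r / 2) ^ m) *
      (Polynomial.Chebyshev.T ℝ m).comp (Polynomial.C r⁻¹ * Polynomial.X + Polynomial.C (-e))

lemma natDegree_monicChebyshev (e : ℝ) {r : ℝ} (hr : 0 < r) (m : ℕ) :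
    (monicChebyshev e r m).natDegree = m := by
  unfold monicChebyshev
  split_ifs with h
  · simp [h]
  · rw [Polynomial.natDegree_C_mul (by positivity), Polynomial.natDegree_comp,
      Polynomial.Chebyshev.natDegree_T, Polynomial.natDegree_linear (by positivity)]
    simp

lemma monic_monicChebyshev (e : ℝ) {r : ℝ} (hr : 0 < r) (m : ℕ) :
    (monicChebyshev e r m).Monic := by
  unfold monicChebyshev
  split_ifs with h
  · exact Polynomial.monic_one
  · obtain ⟨k, rfl⟩ := Nat.exists_eq_succ_of_ne_zero h
    rw [Polynomial.Monic, Polynomial.leadingCoeff_mul, Polynomial.leadingCoeff_C,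
      Polynomial.leadingCoeff_comp (by rw [Polynomial.natDegree_linear (by positivity)]; simp),
      Polynomial.Chebyshev.leadingCoeff_T, Polynomial.Chebyshev.natDegree_T,
      Polynomial.leadingCoeff_linear (by positivity)]
    have : ((k.succ : ℕ) : ℤ).natAbs = k + 1 := by omega
    rw [this, Nat.add_sub_cancel, Nat.succ_eq_add_one, div_pow, inv_pow]
    field_simp
    ring

lemma abs_eval_monicChebyshev_le (e : ℝ) {r : ℝ} (hr : 0 < r) (m : ℕ) (x : ℝ) :
    |(monicChebyshev e r m).eval x| ≤
      2 * (r / 2) ^ m * Real.exp (m * intervalGreen (x / r - e)) := by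
  unfold monicChebyshev
  split_ifs with h
  · simp [h]
  · have h1 : 0 ≤ 2 * (r / 2) ^ m := by positivity
    rw [Polynomial.eval_mul, Polynomial.eval_C, Polynomial.eval_comp, abs_mul, abs_of_nonneg h1]
    refine mul_le_mul_of_nonneg_left ?_ h1
    have h2 : (Polynomial.C r⁻¹ * Polynomial.X + Polynomial.C (-e)).eval x = x / r - e := by
      simp [div_eq_inv_mul, sub_eq_add_neg]
    rw [h2]
    exact abs_eval_T_le_exp m _

/-- Comparison of a sum of values of the inverse of `y * s` with the integral `y * H`,
for `H` concave with derivative at least `s`. -/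
lemma sum_inverse_le {H s : ℝ → ℝ} {M y : ℝ}
    (hH : ∀ u v, 0 ≤ v → v ≤ u → s u * (u - v) ≤ H u - H v) (h0 : H 0 = 0)
    (hM : ∀ u, H u ≤ M) (hy : 0 ≤ y) {u : ℕ → ℝ} (hu : ∀ j, 0 ≤ u j) (hanti : Antitone u)
    (hinv : ∀ j : ℕ, u j = 0 ∨ (j + 1 : ℝ) ≤ y * s (u j)) (J : ℕ) :
    ∑ j ∈ Finset.range J, u j ≤ y * M := by
  have step : ∀ J : ℕ, ∑ j ∈ Finset.range (J + 1), u j ≤ (J + 1) * u J - y * H (u J) + y * M := by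
    intro J
    induction J with
    | zero =>
      have := mul_le_mul_of_nonneg_left (hM (u 0)) hy
      simp only [zero_add, Finset.sum_range_one, Nat.cast_zero, one_mul]
      linarith
    | succ k ih =>
      rw [Finset.sum_range_succ]
      have hmono : u (k + 1) ≤ u k := hanti (Nat.le_succ k)
      have hk := hu (k + 1)
      push_cast
      rcases hinv k with h | h
      · have h1 : u (k + 1) = 0 := le_antisymm (h ▸ hmono) hk
        rw [h1]
        rw [h] at ih
        linarith
      · have h2 := mul_le_mul_of_nonneg_left (hH _ _ hk hmono) hy
        have h3 := mul_le_mul_of_nonneg_right h (sub_nonneg.2 hmono)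
        nlinarith
  rcases J with _ | J
  · have := mul_nonneg hy ((h0 ▸ hM 0 : (0 : ℝ) ≤ M))
    simpa using this
  · refine (step J).trans ?_
    rcases hinv J with h | h
    · rw [h, h0]; simp
    · have h2 := mul_le_mul_of_nonneg_left (hH _ 0 le_rfl (hu J)) hy
      have h3 := mul_le_mul_of_nonneg_right h (hu J)
      rw [h0] at h2
      nlinarith

lemma sech_sq_mul_sub_le {u v : ℝ} (hv : 0 ≤ v) (hvu : v ≤ u) :
    (Real.cosh u ^ 2)⁻¹ * (u - v) ≤ Real.tanh u - Real.tanh v := by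
  have hcu := Real.cosh_pos u
  have hcv := Real.cosh_pos v
  have hle : Real.cosh v ≤ Real.cosh u := by
    rw [Real.cosh_le_cosh, abs_of_nonneg hv, abs_of_nonneg (hv.trans hvu)]; exact hvu
  have h1 : u - v ≤ Real.sinh (u - v) := Real.self_le_sinh_iff.2 (by linarith)
  have h2 : Real.tanh u - Real.tanh v = Real.sinh (u - v) / (Real.cosh u * Real.cosh v) := by
    rw [Real.tanh_eq_sinh_div_cosh, Real.tanh_eq_sinh_div_cosh, Real.sinh_sub]
    field_simp
  rw [h2, inv_mul_eq_div]
  have h0 : 0 ≤ u - v := by linarith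
  apply div_le_div₀ (h0.trans h1) h1 (by positivity)
  nlinarith

lemma sech_four_mul_sub_le {u v : ℝ} (hv : 0 ≤ v) (hvu : v ≤ u) :
    (Real.cosh u ^ 4)⁻¹ * (u - v) ≤
      (Real.tanh u - Real.tanh u ^ 3 / 3) - (Real.tanh v - Real.tanh v ^ 3 / 3) := by
  have hcu := Real.cosh_pos u
  have h := sech_sq_mul_sub_le hv hvu
  have hs : (Real.cosh u ^ 2)⁻¹ = 1 - Real.tanh u ^ 2 := by
    rw [Real.tanh_eq_sinh_div_cosh]
    field_simp
    rw [Real.cosh_sq]; ring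
  have hpos : 0 ≤ (Real.cosh u ^ 2)⁻¹ := by positivity
  have h4 : (Real.cosh u ^ 4)⁻¹ = (Real.cosh u ^ 2)⁻¹ * (Real.cosh u ^ 2)⁻¹ := by
    rw [← mul_inv]; ring_nf
  have htv : 0 ≤ Real.tanh v := by
    rw [Real.tanh_eq_sinh_div_cosh]
    exact div_nonneg (Real.sinh_nonneg_iff.2 hv) (Real.cosh_pos _).le
  have htu : Real.tanh v ≤ Real.tanh u := by
    have := mul_nonneg hpos (sub_nonneg.2 hvu)
    linarith
  have h5 := mul_le_mul_of_nonneg_left h hpos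
  rw [h4, mul_assoc]
  refine h5.trans ?_
  rw [hs]
  set a := Real.tanh u
  set b := Real.tanh v
  have : (a - a ^ 3 / 3) - (b - b ^ 3 / 3) - (1 - a ^ 2) * (a - b) =
    (a - b) * ((a - b) * (2 * a + b)) / 3 := by ring
  have h6 : 0 ≤ (a - b) * ((a - b) * (2 * a + b)) / 3 := by
    have : 0 ≤ a - b := by linarith
    have : 0 ≤ 2 * a + b := by linarith
    positivity
  linarith

lemma antitone_intervalGreen_div_sqrt {L δ : ℝ} (hL : 0 < L) (hδ : 0 < δ) (x : ℝ) :
    Antitone fun j : ℕ => |x / (L * √(δ * (j + 1)))| := by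
  intro i j hij
  simp only [abs_div]
  have : (i : ℝ) ≤ j := by exact_mod_cast hij
  gcongr

lemma sum_intervalGreen_line {δ : ℝ} (hδ : 0 < δ) (J : ℕ) (x : ℝ) :
    ∑ j ∈ Finset.range J, intervalGreen (x / (√2 * √(δ * (j + 1))) - 0) ≤ x ^ 2 / (2 * δ) := by
  have hanti := antitone_intervalGreen_div_sqrt (L := √2) (by positivity) hδ x
  have key := sum_inverse_le (H := Real.tanh) (s := fun u => (Real.cosh u ^ 2)⁻¹) (M := 1)
    (y := x ^ 2 / (2 * δ)) (fun u v hv hvu => sech_sq_mul_sub_le hv hvu) Real.tanh_zero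
    (fun u => (Real.tanh_lt_one u).le) (by positivity)
    (u := fun j : ℕ => intervalGreen (x / (√2 * √(δ * (j + 1))) - 0))
    (fun j => intervalGreen_nonneg _)
    (fun i j hij => intervalGreen_mono (by
      simpa only [sub_zero] using (hanti hij).trans (le_max_right _ _)))
    (fun j => by
      rcases le_total |x / (√2 * √(δ * (j + 1))) - 0| 1 with h | h
      · exact Or.inl (intervalGreen_of_abs_le_one h)
      · right
        simp only [cosh_intervalGreen, max_eq_right h]
        rw [sq_abs, sub_zero, div_pow, mul_pow, Real.sq_sqrt (by positivity),
          Real.sq_sqrt (by positivity), inv_div]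
        have hx : x ≠ 0 := by
          rintro rfl
          norm_num at h
        apply le_of_eq
        field_simp) J
  simpa using key

lemma sum_intervalGreen_half_line {δ : ℝ} (hδ : 0 < δ) (J : ℕ) {x : ℝ} (hx : 0 ≤ x) :
    ∑ j ∈ Finset.range J, intervalGreen (x / (√(2 / 3) * √(δ * (j + 1))) - 1) ≤
      x ^ 2 / (2 * δ) := by
  have hanti := antitone_intervalGreen_div_sqrt (L := √(2 / 3)) (by positivity) hδ x
  have hnn : ∀ j : ℕ, 0 ≤ x / (√(2 / 3) * √(δ * (j + 1))) := fun j => by positivity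
  have key := sum_inverse_le (H := fun u => Real.tanh u - Real.tanh u ^ 3 / 3)
    (s := fun u => (Real.cosh u ^ 4)⁻¹) (M := 2 / 3)
    (y := x ^ 2 * (3 / (8 * δ))) (fun u v hv hvu => sech_four_mul_sub_le hv hvu) (by simp)
    (fun u => by
      have h1 := Real.tanh_lt_one u
      have h2 := Real.neg_one_lt_tanh u
      nlinarith [mul_nonneg (sq_nonneg (1 - Real.tanh u)) (by linarith : 0 ≤ Real.tanh u + 2)])
    (by positivity)
    (u := fun j : ℕ => intervalGreen (x / (√(2 / 3) * √(δ * (j + 1))) - 1) / 2)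
    (fun j => div_nonneg (intervalGreen_nonneg _) (by norm_num))
    (fun i j hij => by
      have h1 := hanti hij
      simp only [abs_of_nonneg (hnn _)] at h1
      have := intervalGreen_mono (x := x / (√(2 / 3) * √(δ * (j + 1))) - 1)
        (y := x / (√(2 / 3) * √(δ * (i + 1))) - 1) (by
          have := hnn j
          rw [abs_le]
          constructor
          · linarith [le_max_left 1 |x / (√(2 / 3) * √(δ * (i + 1))) - 1|]
          · exact le_max_of_le_right (le_trans (by linarith) (le_abs_self _)))
      simp only
      linarith)
    (fun j => by
      rcases le_total (x / (√(2 / 3) * √(δ * (j + 1)))) 2 with h2 | h2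
      · left
        have := hnn j
        rw [intervalGreen_of_abs_le_one (abs_le.2 ⟨by linarith, by linarith⟩), zero_div]
      · right
        have h : 1 ≤ |x / (√(2 / 3) * √(δ * (j + 1))) - 1| :=
          le_trans (by linarith) (le_abs_self _)
        have h3 : Real.cosh (intervalGreen (x / (√(2 / 3) * √(δ * (j + 1))) - 1) / 2) ^ 2 =
            x / (√(2 / 3) * √(δ * (j + 1))) / 2 := by
          have h4 := cosh_intervalGreen (x / (√(2 / 3) * √(δ * (j + 1))) - 1)
          rw [max_eq_right h, abs_of_nonneg (by linarith)] at h4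
          rw [Real.cosh_sq']
          have h5 := Real.cosh_two_mul (intervalGreen (x / (√(2 / 3) * √(δ * (j + 1))) - 1) / 2)
          rw [Real.cosh_sq', mul_div_cancel₀ _ (two_ne_zero), h4] at h5
          linarith
        have h6 : ∀ a : ℝ, a ^ 4 = (a ^ 2) ^ 2 := fun a => by ring
        simp only [h6, h3]
        have hx : x ≠ 0 := by
          rintro rfl
          norm_num at h2
        rw [div_pow, div_pow, mul_pow, Real.sq_sqrt (by positivity),
          Real.sq_sqrt (by positivity), inv_div]
        apply le_of_eq
        field_simp
        norm_num) J
  rw [← Finset.sum_div] at key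
  have : x ^ 2 / (2 * δ) = 2 * (x ^ 2 * (3 / (8 * δ)) * (2 / 3)) := by
    field_simp; norm_num
  linarith

/-- The bound obtained for monic polynomials of degree `k` built from blocks of size `m`. -/
noncomputable def blockBound (L N : ℝ) (m k : ℕ) : ℝ :=
  2 ^ (k / m + 1) * ∏ i ∈ Finset.range k, (L / 2 * √((i + m) / N))

lemma exists_monic_mul_block {L N e : ℝ} (hL : 0 < L) (hN : 0 < N) {m : ℕ} (hm : 0 < m)
    {q : ℕ} {p : Polynomial ℝ} (hp : p.Monic) (hdeg : p.natDegree = q * m)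
    (hbd : ∀ x, |p.eval x| ≤ 2 ^ q * (∏ i ∈ Finset.range (q * m), (L / 2 * √((i + m) / N))) *
      Real.exp (m * ∑ j ∈ Finset.range q, intervalGreen (x / (L * √(m / N * (j + 1))) - e)))
    {s : ℕ} (hs : s ≤ m) :
    ∃ p' : Polynomial ℝ, p'.Monic ∧ p'.natDegree = q * m + s ∧
      ∀ x, |p'.eval x| ≤
        2 ^ (q + 1) * (∏ i ∈ Finset.range (q * m + s), (L / 2 * √((i + m) / N))) *
        Real.exp (m * ∑ j ∈ Finset.range (q + 1),
          intervalGreen (x / (L * √(m / N * (j + 1))) - e)) := by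
  have hm' : (0 : ℝ) < m := by exact_mod_cast hm
  set r : ℝ := L * √(m / N * (q + 1)) with hr_def
  have hr : 0 < r := by positivity
  refine ⟨p * monicChebyshev e r s, hp.mul (monic_monicChebyshev e hr s), ?_, fun x => ?_⟩
  · rw [hp.natDegree_mul (monic_monicChebyshev e hr s), hdeg, natDegree_monicChebyshev e hr]
  · rw [Polynomial.eval_mul, abs_mul, Finset.prod_range_add, Finset.sum_range_succ, mul_add,
      Real.exp_add, pow_succ]
    have h1 := abs_eval_monicChebyshev_le e hr s x
    have h2 : (r / 2) ^ s ≤ ∏ i ∈ Finset.range s, (L / 2 * √(((q * m + i : ℕ) + m) / N)) := by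
      calc (r / 2) ^ s = ∏ i ∈ Finset.range s, (r / 2) := by rw [Finset.prod_const, Finset.card_range]
        _ ≤ _ := by
          refine Finset.prod_le_prod (fun _ _ => by positivity) (fun i _ => ?_)
          have : r / 2 = L / 2 * √(m / N * (q + 1)) := by rw [hr_def]; ring
          rw [this]
          refine mul_le_mul_of_nonneg_left (Real.sqrt_le_sqrt ?_) (by positivity)
          rw [div_mul_eq_mul_div]
          gcongr
          push_cast
          nlinarith [Nat.cast_nonneg (α := ℝ) i]
    have h3 : Real.exp (s * intervalGreen (x / r - e)) ≤
        Real.exp (m * intervalGreen (x / r - e)) := by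
      refine Real.exp_le_exp.2 (mul_le_mul_of_nonneg_right ?_ (intervalGreen_nonneg _))
      exact_mod_cast hs
    calc |p.eval x| * |(monicChebyshev e r s).eval x|
        ≤ (2 ^ q * (∏ i ∈ Finset.range (q * m), (L / 2 * √((i + m) / N))) *
          Real.exp (m * ∑ j ∈ Finset.range q, intervalGreen (x / (L * √(m / N * (j + 1))) - e))) *
          (2 * (∏ i ∈ Finset.range s, (L / 2 * √(((q * m + i : ℕ) + m) / N))) *
            Real.exp (m * intervalGreen (x / r - e))) := by
          refine mul_le_mul (hbd x) (h1.trans ?_) (abs_nonneg _) (by positivity)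
          gcongr
      _ = _ := by ring

lemma exists_monic_blocks {L N : ℝ} (e : ℝ) (hL : 0 < L) (hN : 0 < N) {m : ℕ} (hm : 0 < m) (q : ℕ) :
    ∃ p : Polynomial ℝ, p.Monic ∧ p.natDegree = q * m ∧
      ∀ x, |p.eval x| ≤ 2 ^ q * (∏ i ∈ Finset.range (q * m), (L / 2 * √((i + m) / N))) *
        Real.exp (m * ∑ j ∈ Finset.range q,
          intervalGreen (x / (L * √(m / N * (j + 1))) - e)) := by
  induction q with
  | zero => exact ⟨1, Polynomial.monic_one, by simp, by simp⟩
  | succ q ih =>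
    obtain ⟨p, hp, hdeg, hbd⟩ := ih
    obtain ⟨p', h1, h2, h3⟩ := exists_monic_mul_block hL hN hm hp hdeg hbd le_rfl
    rw [← Nat.succ_mul] at h2 h3
    exact ⟨p', h1, h2, h3⟩

/-- The intervals `[L √t (e - 1), L √t (e + 1)]`, `0 ≤ t ≤ 1`, carry the arcsine laws whose mixture
is the equilibrium measure of `S` in the external field `x ^ 2 / 2`; this is the resulting
inequality for potentials, in discretized form. -/
def GreenSumBound (S : Set ℝ) (e L : ℝ) : Prop :=
  ∀ δ : ℝ, 0 < δ → ∀ J : ℕ, ∀ x ∈ S,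
    ∑ j ∈ Finset.range J, intervalGreen (x / (L * √(δ * (j + 1))) - e) ≤ x ^ 2 / (2 * δ)

lemma exists_monic_abs_le {S : Set ℝ} {e L N : ℝ} (hS : GreenSumBound S e L) (hL : 0 < L)
    (hN : 0 < N) {m : ℕ} (hm : 0 < m) (k : ℕ) :
    ∃ p : Polynomial ℝ, p.Monic ∧ p.natDegree = k ∧
      ∀ x ∈ S, |p.eval x| ≤ blockBound L N m k * Real.exp (N * x ^ 2 / 2) := by
  have hm' : (0 : ℝ) < m := by exact_mod_cast hm
  obtain ⟨p, hp, hdeg, hbd⟩ := exists_monic_blocks e hL hN hm (k / m)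
  obtain ⟨p', h1, h2, h3⟩ :=
    exists_monic_mul_block hL hN hm hp hdeg hbd (Nat.mod_lt k hm).le
  rw [Nat.div_add_mod'] at h2 h3
  refine ⟨p', h1, h2, fun x hx => (h3 x).trans ?_⟩
  unfold blockBound
  refine mul_le_mul_of_nonneg_left (Real.exp_le_exp.2 ?_) (by positivity)
  refine (mul_le_mul_of_nonneg_left (hS (m / N) (by positivity) (k / m + 1) x hx) hm'.le).trans ?_
  apply le_of_eq
  field_simp

lemma abs_vandermonde_le {n : ℕ} {S : Set ℝ} {C : ℕ → ℝ} {g : ℝ → ℝ}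
    (hp : ∀ k, ∃ p : Polynomial ℝ, p.Monic ∧ p.natDegree = k ∧ ∀ x ∈ S, |p.eval x| ≤ C k * g x)
    {x : Fin n → ℝ} (hx : ∀ i, x i ∈ S) :
    ∏ i, ∏ j ∈ Finset.Ioi i, |x i - x j| ≤
      n.factorial * (∏ k ∈ Finset.range n, C k) * ∏ i, g (x i) := by
  choose p hmonic hdeg hbd using hp
  have h1 : ∏ i, ∏ j ∈ Finset.Ioi i, |x i - x j| = |(Matrix.vandermonde x).det| := by
    rw [Matrix.det_vandermonde, Finset.abs_prod]
    refine Finset.prod_congr rfl fun i _ => ?_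
    rw [Finset.abs_prod]
    exact Finset.prod_congr rfl fun j _ => abs_sub_comm _ _
  rw [h1, Matrix.det_eval_matrixOfPolynomials_eq_det_vandermonde x (fun i : Fin n => p i)
    (fun i => hdeg i) (fun i => hmonic i), Matrix.det_apply]
  refine (Finset.abs_sum_le_sum_abs _ _).trans ?_
  calc ∑ σ : Equiv.Perm (Fin n), _
      ≤ ∑ σ : Equiv.Perm (Fin n), (∏ k ∈ Finset.range n, C k) * ∏ i, g (x i) := by
        refine Finset.sum_le_sum fun σ _ => ?_
        have h2 : ∀ a : ℝ, |Equiv.Perm.sign σ • a| = |a| := fun a => by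
          rcases Int.units_eq_one_or (Equiv.Perm.sign σ) with h | h <;> simp [h]
        rw [h2, Finset.abs_prod, ← Fin.prod_univ_eq_prod_range C n,
          ← Equiv.prod_comp σ (fun i => g (x i)), ← Finset.prod_mul_distrib]
        exact Finset.prod_le_prod (fun _ _ => abs_nonneg _) fun i _ => hbd i _ (hx _)
    _ = _ := by
        rw [Finset.sum_const, Finset.card_univ, Fintype.card_perm, Fintype.card_fin, nsmul_eq_mul,
          mul_assoc]

/-- The unnormalized density of the Gaussian `β`-ensemble. -/
noncomputable def ensembleDensity (a β : ℝ) (n : ℕ) (x : Fin n → ℝ) : ℝ :=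
  Real.exp (-(a * β / 2) * ∑ i, x i ^ 2) * ∏ i, ∏ j ∈ Finset.Ioi i, |x i - x j| ^ β

lemma continuous_ensembleDensity (a : ℝ) {β : ℝ} (hβ : 0 < β) (n : ℕ) :
    Continuous (ensembleDensity a β n) := by
  unfold ensembleDensity
  refine Continuous.mul (by fun_prop) ?_
  refine continuous_finsetProd _ fun i _ => continuous_finsetProd _ fun j _ => ?_
  exact Continuous.rpow_const (by fun_prop) fun _ => Or.inr hβ.le

lemma ensembleDensity_nonneg (a β : ℝ) (n : ℕ) (x : Fin n → ℝ) : 0 ≤ ensembleDensity a β n x := by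
  unfold ensembleDensity
  positivity

lemma ensembleDensity_le {S : Set ℝ} {e L β : ℝ} (hS : GreenSumBound S e L) (hL : 0 < L)
    (hβ : 0 < β) {n : ℕ} (hn : 2 ≤ n) {m : ℕ} (hm : 0 < m) {x : Fin n → ℝ} (hx : ∀ i, x i ∈ S) :
    ensembleDensity n β n x ≤
      (n.factorial * ∏ k ∈ Finset.range n, blockBound L (n - 1) m k) ^ β *
        ∏ i, Real.exp (-(β / 2) * x i ^ 2) := by
  have hn' : (2 : ℝ) ≤ n := by exact_mod_cast hn
  have hN : (0 : ℝ) < n - 1 := by linarith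
  have h1 := abs_vandermonde_le (fun k => exists_monic_abs_le hS hL hN hm k) hx
  have hC : ∀ k, 0 ≤ blockBound L (n - 1) m k := fun k => by
    unfold blockBound; positivity
  have hP : 0 ≤ (n.factorial : ℝ) * ∏ k ∈ Finset.range n, blockBound L (n - 1) m k :=
    mul_nonneg (Nat.cast_nonneg _) (Finset.prod_nonneg fun k _ => hC k)
  unfold ensembleDensity
  have h2 : ∏ i, ∏ j ∈ Finset.Ioi i, |x i - x j| ^ β =
      (∏ i, ∏ j ∈ Finset.Ioi i, |x i - x j|) ^ β := by
    rw [← Real.finsetProd_rpow _ _ (fun i _ => Finset.prod_nonneg fun j _ => abs_nonneg _)]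
    refine Finset.prod_congr rfl fun i _ => ?_
    rw [← Real.finsetProd_rpow _ _ (fun j _ => abs_nonneg _)]
  rw [h2]
  have h3 := Real.rpow_le_rpow (Finset.prod_nonneg fun i _ => Finset.prod_nonneg fun j _ =>
    abs_nonneg (x i - x j)) h1 hβ.le
  rw [Real.mul_rpow hP (Finset.prod_nonneg fun i _ => (Real.exp_pos _).le), ← Real.exp_sum,
    ← Real.exp_mul] at h3
  refine (mul_le_mul_of_nonneg_left h3 (Real.exp_pos _).le).trans (le_of_eq ?_)
  rw [mul_left_comm, ← Real.exp_add, ← Real.exp_sum]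
  congr 2
  rw [Finset.mul_sum, Finset.sum_mul, ← Finset.sum_add_distrib]
  refine Finset.sum_congr rfl fun i _ => ?_
  ring

open MeasureTheory in
lemma integrableOn_ensembleDensity_and_le {S : Set ℝ} {e L β : ℝ} (hS : GreenSumBound S e L)
    (hSm : MeasurableSet S) (hL : 0 < L) (hβ : 0 < β) {n : ℕ} (hn : 2 ≤ n) {m : ℕ} (hm : 0 < m) :
    IntegrableOn (ensembleDensity n β n) {x : Fin n → ℝ | ∀ i, x i ∈ S} ∧
    ∫ x in {x : Fin n → ℝ | ∀ i, x i ∈ S}, ensembleDensity n β n x ≤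
      (n.factorial * ∏ k ∈ Finset.range n, blockBound L (n - 1) m k) ^ β *
        √(Real.pi / (β / 2)) ^ n := by
  have hD : MeasurableSet {x : Fin n → ℝ | ∀ i, x i ∈ S} := by
    rw [Set.ofPred_forall]
    exact MeasurableSet.iInter fun i => measurable_pi_apply i hSm
  have hint : Integrable fun x : Fin n → ℝ =>
      (n.factorial * ∏ k ∈ Finset.range n, blockBound L (n - 1) m k) ^ β *
        ∏ i, Real.exp (-(β / 2) * x i ^ 2) := by
    refine Integrable.const_mul ?_ _
    exact Integrable.fintype_prod (f := fun (_ : Fin n) (y : ℝ) => Real.exp (-(β / 2) * y ^ 2))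
      fun _ => integrable_exp_neg_mul_sq (by positivity)
  have hle : ∀ x ∈ {x : Fin n → ℝ | ∀ i, x i ∈ S}, ensembleDensity n β n x ≤
      (n.factorial * ∏ k ∈ Finset.range n, blockBound L (n - 1) m k) ^ β *
        ∏ i, Real.exp (-(β / 2) * x i ^ 2) := fun x hx => ensembleDensity_le hS hL hβ hn hm hx
  have h1 : IntegrableOn (ensembleDensity n β n) {x : Fin n → ℝ | ∀ i, x i ∈ S} := by
    refine Integrable.mono' hint.integrableOn
      (continuous_ensembleDensity n hβ n).aestronglyMeasurable ?_
    filter_upwards [ae_restrict_mem hD] with x hx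
    rw [Real.norm_of_nonneg (ensembleDensity_nonneg _ _ _ _)]
    exact hle x hx
  refine ⟨h1, (setIntegral_mono_on h1 hint.integrableOn hD hle).trans ?_⟩
  refine (setIntegral_le_integral hint (Filter.Eventually.of_forall fun x => ?_)).trans ?_
  · have hC : ∀ k, 0 ≤ blockBound L (n - 1) m k := fun k => by
      unfold blockBound; positivity
    have hP : 0 ≤ (n.factorial : ℝ) * ∏ k ∈ Finset.range n, blockBound L (n - 1) m k :=
      mul_nonneg (Nat.cast_nonneg _) (Finset.prod_nonneg fun k _ => hC k)
    exact mul_nonneg (Real.rpow_nonneg hP _) (Finset.prod_nonneg fun _ _ => (Real.exp_pos _).le)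
  · rw [integral_const_mul,
      integral_fintype_prod_volume_eq_pow (fun y : ℝ => Real.exp (-(β / 2) * y ^ 2)),
      integral_gaussian, Fintype.card_fin]

lemma intervalIntegrable_log_cos_sub (c a b : ℝ) :
    IntervalIntegrable (fun φ => Real.log (Real.cos φ - c)) MeasureTheory.volume a b :=
  MeromorphicOn.intervalIntegrable_log (f := fun φ => Real.cos φ - c) fun x _ => by
    have : AnalyticAt ℝ (fun φ => Real.cos φ - c) x := by fun_prop
    exact this.meromorphicAt

lemma ae_cos_sub_ne_zero {c : ℝ} :
    ∀ᵐ φ : ℝ, φ ∈ Set.Icc 0 Real.pi → Real.cos φ - c ≠ 0 := by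
  have h : ∀ᵐ φ : ℝ, φ ≠ Real.arccos c := by
    simp [MeasureTheory.ae_iff]
  filter_upwards [h] with φ hφ hm h0
  apply hφ
  rw [← sub_eq_zero.1 h0, Real.arccos_cos hm.1 hm.2]

lemma intervalIntegrable_log_sin_half_s18 (θ a b : ℝ) :
    IntervalIntegrable (fun φ => Real.log (Real.sin ((φ + θ) / 2))) MeasureTheory.volume a b :=
  MeromorphicOn.intervalIntegrable_log (f := fun φ => Real.sin ((φ + θ) / 2)) fun x _ => by
    have : AnalyticAt ℝ (fun φ => Real.sin ((φ + θ) / 2)) x := by fun_prop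
    exact this.meromorphicAt

lemma integral_log_cos_sub {c : ℝ} (hc : |c| ≤ 1) :
    ∫ φ in (0 : ℝ)..Real.pi, Real.log (Real.cos φ - c) = -Real.log 2 * Real.pi := by
  obtain ⟨h1, h2⟩ := abs_le.1 hc
  set θ := Real.arccos c with hθ
  have hcos : Real.cos θ = c := Real.cos_arccos h1 h2
  have e1 : ∫ φ in (0 : ℝ)..Real.pi, Real.log (Real.cos φ - c) =
      ∫ φ in (0 : ℝ)..Real.pi, (Real.log 2 + Real.log (Real.sin ((φ + θ) / 2)) +
        Real.log (Real.sin ((-φ + θ) / 2))) := by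
    refine intervalIntegral.integral_congr_ae ?_
    filter_upwards [ae_cos_sub_ne_zero (c := c)] with φ hφ hm
    rw [Set.uIoc_of_le Real.pi_pos.le] at hm
    have h0 := hφ ⟨hm.1.le, hm.2⟩
    have h3 : Real.cos φ - c = 2 * Real.sin ((φ + θ) / 2) * Real.sin ((-φ + θ) / 2) := by
      rw [← hcos, Real.cos_sub_cos, show (-φ + θ) / 2 = -((φ - θ) / 2) by ring, Real.sin_neg]
      ring
    rw [h3] at h0 ⊢
    rw [Real.log_mul (left_ne_zero_of_mul h0) (right_ne_zero_of_mul h0),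
      Real.log_mul two_ne_zero (right_ne_zero_of_mul (left_ne_zero_of_mul h0))]
  have i1 := intervalIntegrable_log_sin_half_s18 θ 0 Real.pi
  have i2 := intervalIntegrable_log_sin_half_s18 θ (-Real.pi) 0
  have i3 : IntervalIntegrable (fun φ => Real.log (Real.sin ((-φ + θ) / 2)))
      MeasureTheory.volume 0 Real.pi := by
    refine MeromorphicOn.intervalIntegrable_log (f := fun φ => Real.sin ((-φ + θ) / 2))
      fun x _ => ?_
    have : AnalyticAt ℝ (fun φ => Real.sin ((-φ + θ) / 2)) x := by fun_prop
    exact this.meromorphicAt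
  have e2 : ∫ φ in (0 : ℝ)..Real.pi, Real.log (Real.sin ((-φ + θ) / 2)) =
      ∫ φ in (-Real.pi)..0, Real.log (Real.sin ((φ + θ) / 2)) := by
    rw [intervalIntegral.integral_comp_neg (fun φ => Real.log (Real.sin ((φ + θ) / 2))), neg_zero]
  have e3 : ∫ φ in (-Real.pi)..Real.pi, Real.log (Real.sin ((φ + θ) / 2)) =
      2 * (-Real.log 2 * Real.pi) := by
    have hcomp := intervalIntegral.integral_comp_add_div
      (fun u => Real.log (Real.sin u)) (two_ne_zero (α := ℝ)) (θ / 2)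
      (a := -Real.pi) (b := Real.pi)
    have : ∀ φ : ℝ, (φ + θ) / 2 = θ / 2 + φ / 2 := fun φ => by ring
    simp only [this]
    rw [hcomp, smul_eq_mul, ← integral_log_sin_zero_pi]
    congr 1
    have hper : Function.Periodic (fun u => Real.log (Real.sin u)) Real.pi := fun u => by
      simp [Real.sin_add_pi, Real.log_neg_eq_log]
    have := hper.intervalIntegral_add_eq (θ / 2 + -Real.pi / 2) 0
    rw [zero_add] at this
    rw [← this]
    congr 1
    ring
  rw [e1, intervalIntegral.integral_add ((_root_.intervalIntegrable_const).add i1) i3,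
    intervalIntegral.integral_add (_root_.intervalIntegrable_const) i1, e2]
  have := intervalIntegral.integral_add_adjacent_intervals i2 i1
  rw [e3] at this
  simp only [intervalIntegral.integral_const, sub_zero, smul_eq_mul]
  linarith

lemma integral_sq_add_cos (e : ℝ) :
    ∫ φ in (0 : ℝ)..Real.pi, (e + Real.cos φ) ^ 2 = Real.pi * (e ^ 2 + 1 / 2) := by
  have : ∀ φ, (e + Real.cos φ) ^ 2 = e ^ 2 + 2 * e * Real.cos φ + Real.cos φ ^ 2 := fun φ => by ring
  simp only [this]
  rw [intervalIntegral.integral_add (Continuous.intervalIntegrable (by fun_prop) _ _)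
    (Continuous.intervalIntegrable (by fun_prop) _ _),
    intervalIntegral.integral_add (Continuous.intervalIntegrable (by fun_prop) _ _)
    (Continuous.intervalIntegrable (by fun_prop) _ _),
    intervalIntegral.integral_const_mul, integral_cos, integral_cos_sq]
  simp
  ring

/-- The lower bound for the factor contributed by a new particle, from Jensen's inequality for the
arcsine law of `[r (e - 1), r (e + 1)]`. -/
noncomputable def arcsineFactor (a β e r : ℝ) (k : ℕ) : ℝ :=
  Real.pi * (r / 2) *
    Real.exp (β * (-(a / 2) * (r ^ 2 * (e ^ 2 + 1 / 2)) + k * Real.log (r / 2)))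

lemma arcsineFactor_le_integral (a e : ℝ) {β r : ℝ} (hβ : 0 < β) (hr : 0 < r) {k : ℕ}
    {y : Fin k → ℝ} (hy : ∀ i, y i ∈ Set.Icc (r * (e - 1)) (r * (e + 1))) :
    arcsineFactor a β e r k ≤ ∫ x in (r * (e - 1))..(r * (e + 1)),
      Real.exp (-(a * β / 2) * x ^ 2) * ∏ i, |x - y i| ^ β := by
  set G : ℝ → ℝ := fun x => Real.exp (-(a * β / 2) * x ^ 2) * ∏ i, |x - y i| ^ β with hG
  have hGc : Continuous G := by
    refine Continuous.mul (by fun_prop) (continuous_finsetProd _ fun i _ => ?_)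
    exact Continuous.rpow_const (by fun_prop) fun _ => Or.inr hβ.le
  have hsub : ∫ x in (r * (e - 1))..(r * (e + 1)), G x =
      ∫ φ in (0 : ℝ)..Real.pi, G (r * (e + Real.cos φ)) * (r * Real.sin φ) := by
    have h := intervalIntegral.integral_comp_mul_deriv (a := 0) (b := Real.pi)
      (f := fun φ => r * (e + Real.cos φ)) (f' := fun φ => r * (-Real.sin φ)) (g := G)
      (fun φ _ => ((Real.hasDerivAt_cos φ).const_add e).const_mul r)
      (by fun_prop) hGc
    simp only [Real.cos_zero, Real.cos_pi, Function.comp_apply] at h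
    rw [← sub_eq_add_neg] at h
    rw [intervalIntegral.integral_symm, ← h, ← intervalIntegral.integral_neg]
    congr 1
    ext φ
    ring
  rw [hsub]
  set c : Fin k → ℝ := fun i => y i / r - e with hc
  have hc1 : ∀ i, |c i| ≤ 1 := fun i => by
    obtain ⟨h1, h2⟩ := hy i
    simp only [hc]
    rw [abs_le]
    constructor
    · rw [le_sub_iff_add_le, le_div_iff₀ hr]; linarith
    · rw [sub_le_iff_le_add, div_le_iff₀ hr]; linarith
  set ψ : ℝ → ℝ := fun φ => (-(a * β / 2) * r ^ 2 * (e + Real.cos φ) ^ 2 +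
    ∑ i, β * (Real.log r + Real.log (Real.cos φ - c i))) + (Real.log r + Real.log (Real.sin φ))
    with hψ
  have iA : IntervalIntegrable (fun φ => -(a * β / 2) * r ^ 2 * (e + Real.cos φ) ^ 2)
      MeasureTheory.volume 0 Real.pi := Continuous.intervalIntegrable (by fun_prop) _ _
  have iB : ∀ i, IntervalIntegrable (fun φ => β * (Real.log r + Real.log (Real.cos φ - c i)))
      MeasureTheory.volume 0 Real.pi := fun i =>
    ((_root_.intervalIntegrable_const).add (intervalIntegrable_log_cos_sub _ _ _)).const_mul _
  have iB' : IntervalIntegrable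
      (fun φ => ∑ i, β * (Real.log r + Real.log (Real.cos φ - c i)))
      MeasureTheory.volume 0 Real.pi := by
    have := IntervalIntegrable.sum Finset.univ (fun i _ => iB i)
    simpa [Finset.sum_fn] using this
  have iS : IntervalIntegrable (fun φ => Real.log (Real.sin φ)) MeasureTheory.volume 0 Real.pi :=
    intervalIntegrable_log_sin
  have iC : IntervalIntegrable (fun φ => Real.log r + Real.log (Real.sin φ))
      MeasureTheory.volume 0 Real.pi := (_root_.intervalIntegrable_const).add iS
  have iψ : IntervalIntegrable ψ MeasureTheory.volume 0 Real.pi := (iA.add iB').add iC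
  set A : ℝ := β * (-(a / 2) * (r ^ 2 * (e ^ 2 + 1 / 2)) + k * Real.log (r / 2)) +
    Real.log (r / 2) with hA
  have hψA : ∫ φ in (0 : ℝ)..Real.pi, ψ φ = Real.pi * A := by
    have hB : ∀ i, ∫ φ in (0 : ℝ)..Real.pi, β * (Real.log r + Real.log (Real.cos φ - c i)) =
        Real.pi * (β * Real.log (r / 2)) := fun i => by
      rw [intervalIntegral.integral_const_mul, intervalIntegral.integral_add
        (_root_.intervalIntegrable_const) (intervalIntegrable_log_cos_sub _ _ _),
        integral_log_cos_sub (hc1 i), Real.log_div hr.ne' two_ne_zero]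
      simp
      ring
    simp only [hψ]
    rw [intervalIntegral.integral_add (iA.add iB') iC, intervalIntegral.integral_add iA iB',
      intervalIntegral.integral_finsetSum (fun i _ => iB i), intervalIntegral.integral_const_mul,
      integral_sq_add_cos, intervalIntegral.integral_add (_root_.intervalIntegrable_const) iS,
      integral_log_sin_zero_pi]
    simp only [hB, hA, Finset.sum_const, Finset.card_univ, Fintype.card_fin, nsmul_eq_mul,
      intervalIntegral.integral_const, smul_eq_mul, sub_zero, Real.log_div hr.ne' two_ne_zero]
    ring
  have hle : (∫ φ in (0 : ℝ)..Real.pi, Real.exp A * (1 - A + ψ φ)) ≤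
      ∫ φ in (0 : ℝ)..Real.pi, G (r * (e + Real.cos φ)) * (r * Real.sin φ) := by
    refine intervalIntegral.integral_mono_ae_restrict Real.pi_pos.le
      (((_root_.intervalIntegrable_const).add iψ).const_mul _)
      (Continuous.intervalIntegrable (by fun_prop) _ _) ?_
    have hae : ∀ᵐ φ : ℝ, ∀ i, φ ∈ Set.Icc 0 Real.pi → Real.cos φ - c i ≠ 0 :=
      MeasureTheory.ae_all_iff.2 fun i => ae_cos_sub_ne_zero
    have h0 : ∀ᵐ φ : ℝ, φ ≠ 0 := by simp [MeasureTheory.ae_iff]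
    have hpi : ∀ᵐ φ : ℝ, φ ≠ Real.pi := by simp [MeasureTheory.ae_iff]
    rw [Filter.EventuallyLE, MeasureTheory.ae_restrict_iff' measurableSet_Icc]
    filter_upwards [hae, h0, hpi] with φ h1 h2 h3 hm
    have hs : 0 < Real.sin φ :=
      Real.sin_pos_of_pos_of_lt_pi (lt_of_le_of_ne hm.1 h2.symm) (lt_of_le_of_ne hm.2 h3)
    have hexp : G (r * (e + Real.cos φ)) * (r * Real.sin φ) = Real.exp (ψ φ) := by
      simp only [hψ, hG]
      rw [Real.exp_add, Real.exp_add, Real.exp_add (Real.log r), Real.exp_log hr, Real.exp_log hs,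
        Real.exp_sum]
      congr 2
      · congr 1; ring
      · refine Finset.prod_congr rfl fun i _ => ?_
        have h4 : r * (e + Real.cos φ) - y i = r * (Real.cos φ - c i) := by
          simp only [hc]; field_simp; ring
        rw [h4, Real.rpow_def_of_pos (abs_pos.2 (mul_ne_zero hr.ne' (h1 i hm))), Real.log_abs,
          Real.log_mul hr.ne' (h1 i hm), mul_comm]
    rw [hexp]
    have h5 := Real.add_one_le_exp (ψ φ - A)
    have h6 := mul_le_mul_of_nonneg_left h5 (Real.exp_pos A).le
    rw [← Real.exp_add, add_sub_cancel] at h6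
    linarith
  refine le_trans (le_of_eq ?_) hle
  rw [intervalIntegral.integral_const_mul,
    intervalIntegral.integral_add (_root_.intervalIntegrable_const) iψ, hψA]
  simp only [intervalIntegral.integral_const, smul_eq_mul, sub_zero, hA, arcsineFactor]
  rw [Real.exp_add, Real.exp_log (by positivity)]
  ring

lemma ensembleDensity_cons (a β : ℝ) {k : ℕ} (t : ℝ) (y : Fin k → ℝ) :
    ensembleDensity a β (k + 1) (Fin.cons t y) =
      ensembleDensity a β k y * (Real.exp (-(a * β / 2) * t ^ 2) * ∏ i, |t - y i| ^ β) := by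
  unfold ensembleDensity
  rw [Fin.sum_univ_succ, Fin.prod_univ_succ, Fin.prod_Ioi_zero]
  simp only [Fin.prod_Ioi_succ, Fin.cons_zero, Fin.cons_succ]
  rw [mul_add, Real.exp_add]
  ring

open MeasureTheory in
lemma prod_arcsineFactor_le_lintegral (a : ℝ) {β e : ℝ} (hβ : 0 < β) (he0 : 0 ≤ e) (he1 : e ≤ 1)
    {ρ : ℕ → ℝ} (hρ : ∀ k, 0 < ρ k) (hmono : Monotone ρ) (n : ℕ) :
    ENNReal.ofReal (∏ k ∈ Finset.range n, arcsineFactor a β e (ρ k) k) ≤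
      ∫⁻ x in {x : Fin n → ℝ | ∀ i, x i ∈ Set.Icc (ρ i.rev * (e - 1)) (ρ i.rev * (e + 1))},
        ENNReal.ofReal (ensembleDensity a β n x) := by
  have hD : ∀ k : ℕ, MeasurableSet
      {x : Fin k → ℝ | ∀ i, x i ∈ Set.Icc (ρ i.rev * (e - 1)) (ρ i.rev * (e + 1))} := fun k => by
    rw [Set.ofPred_forall]
    exact MeasurableSet.iInter fun i => measurable_pi_apply i measurableSet_Icc
  have hf0 : ∀ k, 0 ≤ arcsineFactor a β e (ρ k) k := fun k => by
    have := hρ k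
    have := Real.pi_pos
    unfold arcsineFactor
    positivity
  induction n with
  | zero => simp [ensembleDensity, volume_pi]
  | succ k ih =>
    have hmp := (volume_preserving_piFinSuccAbove (fun _ : Fin (k + 1) => ℝ) 0).symm
    have hmeas : Measurable fun x : Fin (k + 1) → ℝ =>
        ENNReal.ofReal (ensembleDensity a β (k + 1) x) :=
      (continuous_ensembleDensity a hβ (k + 1)).measurable.ennreal_ofReal
    rw [← hmp.setLIntegral_comp_preimage (hD (k + 1)) hmeas]
    have hpre : (MeasurableEquiv.piFinSuccAbove (fun _ : Fin (k + 1) => ℝ) 0).symm ⁻¹'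
        {x : Fin (k + 1) → ℝ | ∀ i, x i ∈ Set.Icc (ρ i.rev * (e - 1)) (ρ i.rev * (e + 1))} =
        Set.Icc (ρ k * (e - 1)) (ρ k * (e + 1)) ×ˢ
          {x : Fin k → ℝ | ∀ i, x i ∈ Set.Icc (ρ i.rev * (e - 1)) (ρ i.rev * (e + 1))} := by
      ext ⟨t, y⟩
      simp [Fin.forall_fin_succ, MeasurableEquiv.piFinSuccAbove_symm_apply, Fin.insertNthEquiv]
    rw [hpre, Measure.volume_eq_prod, setLIntegral_prod_symm _ (by
      exact (hmeas.comp (MeasurableEquiv.measurable _)).aemeasurable)]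
    rw [Finset.prod_range_succ, ENNReal.ofReal_mul (Finset.prod_nonneg fun k _ => hf0 k)]
    refine (mul_le_mul_left ih _).trans ?_
    rw [← lintegral_mul_const _
      (continuous_ensembleDensity a hβ k).measurable.ennreal_ofReal]
    refine setLIntegral_mono' (hD k) fun y hy => ?_
    have hcons : ∀ t : ℝ, (MeasurableEquiv.piFinSuccAbove (fun _ : Fin (k + 1) => ℝ) 0).symm (t, y)
        = Fin.cons t y := fun t => by
      simp [MeasurableEquiv.piFinSuccAbove_symm_apply, Fin.insertNthEquiv]
    simp only [hcons, ensembleDensity_cons, ENNReal.ofReal_mul (ensembleDensity_nonneg a β k y)]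
    have hGc : Continuous fun t : ℝ => Real.exp (-(a * β / 2) * t ^ 2) * ∏ i, |t - y i| ^ β := by
      refine Continuous.mul (by fun_prop) (continuous_finsetProd _ fun i _ => ?_)
      exact Continuous.rpow_const (by fun_prop) fun _ => Or.inr hβ.le
    rw [lintegral_const_mul _ hGc.measurable.ennreal_ofReal]
    refine mul_le_mul_right ?_ _
    have hle : ρ k * (e - 1) ≤ ρ k * (e + 1) :=
      mul_le_mul_of_nonneg_left (by linarith) (hρ k).le
    rw [← ofReal_integral_eq_lintegral_ofReal hGc.integrableOn_Icc
      (Filter.Eventually.of_forall fun t => by positivity), integral_Icc_eq_integral_Ioc,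
      ← intervalIntegral.integral_of_le hle]
    refine ENNReal.ofReal_le_ofReal (arcsineFactor_le_integral a e hβ (hρ k) fun i => ?_)
    have hk : ρ i.rev ≤ ρ k := hmono (by have := i.rev.isLt; omega)
    obtain ⟨h1, h2⟩ := hy i
    constructor
    · nlinarith
    · nlinarith

open MeasureTheory in
lemma prod_arcsineFactor_le_integral {S : Set ℝ} {a β e : ℝ} (hβ : 0 < β)
    (he0 : 0 ≤ e) (he1 : e ≤ 1) (hS : ∀ r > 0, Set.Icc (r * (e - 1)) (r * (e + 1)) ⊆ S)
    {ρ : ℕ → ℝ} (hρ : ∀ k, 0 < ρ k) (hmono : Monotone ρ) {n : ℕ}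
    (hint : IntegrableOn (ensembleDensity a β n) {x : Fin n → ℝ | ∀ i, x i ∈ S}) :
    ∏ k ∈ Finset.range n, arcsineFactor a β e (ρ k) k ≤
      ∫ x in {x : Fin n → ℝ | ∀ i, x i ∈ S}, ensembleDensity a β n x := by
  have hnn : ∀ x, 0 ≤ ensembleDensity a β n x := ensembleDensity_nonneg a β n
  rw [← ENNReal.ofReal_le_ofReal_iff (integral_nonneg hnn),
    ofReal_integral_eq_lintegral_ofReal hint (Filter.Eventually.of_forall hnn)]
  refine (prod_arcsineFactor_le_lintegral a hβ he0 he1 hρ hmono n).trans ?_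
  exact lintegral_mono_set fun x hx i => hS _ (hρ _) (hx i)

lemma log_factorial_le (k : ℕ) :
    Real.log k.factorial ≤ (k + 1) * Real.log (k + 1) - k := by
  induction k with
  | zero => simp
  | succ k ih =>
    have h : 1 - ((k + 2 : ℝ) / (k + 1))⁻¹ ≤ Real.log ((k + 2 : ℝ) / (k + 1)) :=
      Real.one_sub_inv_le_log_of_pos (by positivity)
    rw [Real.log_div (by positivity) (by positivity), inv_div] at h
    have h2 : 1 ≤ ((k : ℝ) + 2) * (Real.log (k + 2) - Real.log (k + 1)) := by
      have : ((k : ℝ) + 2) * (1 - (k + 1) / (k + 2)) = 1 := by field_simp; ring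
      exact this.ge.trans (mul_le_mul_of_nonneg_left h (by positivity))
    rw [Nat.factorial_succ, Nat.cast_mul, Real.log_mul (by positivity) (by positivity)]
    push_cast
    rw [show (k : ℝ) + 1 + 1 = k + 2 by ring]
    linarith

lemma sum_log_succ (k : ℕ) : ∑ i ∈ Finset.range k, Real.log (i + 1) = Real.log k.factorial := by
  rw [← Finset.prod_range_add_one_eq_factorial, Nat.cast_prod, Real.log_prod fun i _ => by positivity]
  simp

lemma sum_inv_succ_le {k n : ℕ} (hkn : k ≤ n) :
    ∑ i ∈ Finset.range k, ((i : ℝ) + 1)⁻¹ ≤ 1 + Real.log n := by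
  have h := harmonic_le_one_add_log n
  rw [harmonic] at h
  push_cast at h
  refine le_trans (Finset.sum_le_sum_of_subset_of_nonneg (Finset.range_mono hkn)
    fun i _ _ => by positivity) h

lemma sum_range_cast (n : ℕ) : ∑ k ∈ Finset.range n, (k : ℝ) = n * (n - 1) / 2 := by
  induction n with
  | zero => simp
  | succ k ih => rw [Finset.sum_range_succ, ih]; push_cast; ring

/-- The part of the logarithm of the partition function, divided by `β`, which is common to the
ensemble on the line and the one on the half-line. -/
noncomputable def commonEnergy (n : ℕ) : ℝ :=
  1 / 2 * ∑ k ∈ Finset.range n, (k : ℝ) * Real.log ((k + 1) / n) - n * (n + 1) / 4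

lemma log_add_div_le {n m : ℕ} (hn : 2 ≤ n) (hm : 0 < m) (i : ℕ) :
    Real.log (((i : ℝ) + m) / (n - 1)) ≤
      Real.log (i + 1) - Real.log n + (m - 1) * ((i : ℝ) + 1)⁻¹ + 2 / n := by
  have hn' : (2 : ℝ) ≤ n := by exact_mod_cast hn
  have hm' : (1 : ℝ) ≤ m := by exact_mod_cast hm
  have hi : (0 : ℝ) ≤ i := Nat.cast_nonneg i
  have h1 : Real.log (((i : ℝ) + m) / (i + 1)) ≤ (m - 1) * ((i : ℝ) + 1)⁻¹ := by
    refine (Real.log_le_sub_one_of_pos (by positivity)).trans (le_of_eq ?_)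
    field_simp
    ring
  have h2 : Real.log ((n : ℝ) / (n - 1)) ≤ 2 / n := by
    refine (Real.log_le_sub_one_of_pos (by apply div_pos <;> linarith)).trans ?_
    have h3 : (0 : ℝ) < n - 1 := by linarith
    rw [div_sub_one h3.ne', div_le_div_iff₀ h3 (by linarith)]
    linarith
  rw [Real.log_div (by positivity) (by positivity)] at h1
  rw [Real.log_div (by positivity) (by linarith)] at h2 ⊢
  linarith

lemma sum_log_blocks_le {n m : ℕ} (hn : 2 ≤ n) (hm : 0 < m) :
    ∑ k ∈ Finset.range n, ∑ i ∈ Finset.range k, Real.log (((i : ℝ) + m) / (n - 1)) ≤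
      2 * commonEnergy n + n * ((m - 1) * (1 + Real.log n) + 3 + Real.log n) := by
  have hn' : (2 : ℝ) ≤ n := by exact_mod_cast hn
  have hm' : (1 : ℝ) ≤ m := by exact_mod_cast hm
  have hk : ∀ k ∈ Finset.range n, ∑ i ∈ Finset.range k, Real.log (((i : ℝ) + m) / (n - 1)) ≤
      k * Real.log ((k + 1) / n) - k + ((m - 1) * (1 + Real.log n) + 2 + Real.log n) := by
    intro k hk
    have hkn : k < n := Finset.mem_range.1 hk
    have hkn' : (k : ℝ) + 1 ≤ n := by exact_mod_cast hkn
    refine (Finset.sum_le_sum fun i _ => log_add_div_le hn hm i).trans ?_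
    simp only [Finset.sum_add_distrib, Finset.sum_sub_distrib, ← Finset.mul_sum, Finset.sum_const,
      Finset.card_range, nsmul_eq_mul, sum_log_succ]
    have h1 := log_factorial_le k
    have h2 := mul_le_mul_of_nonneg_left (sum_inv_succ_le hkn.le)
      (show (0 : ℝ) ≤ m - 1 by linarith)
    have h3 : Real.log (k + 1) ≤ Real.log n := Real.log_le_log (by positivity) hkn'
    have h4 : (k : ℝ) * (2 / n) ≤ 2 := by
      rw [mul_div_assoc', div_le_iff₀ (by linarith)]; linarith
    rw [Real.log_div (by positivity) (by linarith)]
    linarith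
  refine (Finset.sum_le_sum hk).trans (le_of_eq ?_)
  rw [Finset.sum_add_distrib, Finset.sum_sub_distrib, sum_range_cast, commonEnergy]
  simp only [Finset.sum_const, Finset.card_range, nsmul_eq_mul]
  ring

lemma log_blockBound {L N : ℝ} (hL : 0 < L) (hN : 0 < N) {m : ℕ} (hm : 0 < m) (k : ℕ) :
    Real.log (blockBound L N m k) = ((k / m : ℕ) + 1) * Real.log 2 + k * Real.log (L / 2) +
      1 / 2 * ∑ i ∈ Finset.range k, Real.log (((i : ℝ) + m) / N) := by
  have hm' : (0 : ℝ) < m := by exact_mod_cast hm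
  have h : ∀ i ∈ Finset.range k, L / 2 * √(((i : ℝ) + m) / N) ≠ 0 := fun i _ => by positivity
  rw [blockBound, Real.log_mul (by positivity) (Finset.prod_ne_zero_iff.2 h), Real.log_pow,
    Real.log_prod h]
  have h2 : ∀ i ∈ Finset.range k, Real.log (L / 2 * √(((i : ℝ) + m) / N)) =
      Real.log (L / 2) + 1 / 2 * Real.log (((i : ℝ) + m) / N) := fun i _ => by
    rw [Real.log_mul (by positivity) (by positivity), Real.log_sqrt (by positivity)]
    ring
  rw [Finset.sum_congr rfl h2, Finset.sum_add_distrib, ← Finset.mul_sum]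
  simp
  ring

lemma blockBound_pos {L N : ℝ} (hL : 0 < L) (hN : 0 < N) {m : ℕ} (hm : 0 < m) (k : ℕ) :
    0 < blockBound L N m k := by
  have hm' : (0 : ℝ) < m := by exact_mod_cast hm
  exact mul_pos (by positivity) (Finset.prod_pos fun i _ => by positivity)

lemma sum_log_blockBound_le {L : ℝ} (hL : 0 < L) {n : ℕ} (hn : 2 ≤ n) :
    ∑ k ∈ Finset.range n, Real.log (blockBound L (n - 1) (n.sqrt + 1) k) ≤
      commonEnergy n + n * (n - 1) / 2 * Real.log (L / 2) + 5 * (n * √n * (1 + Real.log n)) := by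
  have hn' : (2 : ℝ) ≤ n := by exact_mod_cast hn
  have hs : (n.sqrt : ℝ) ≤ √n := Real.nat_sqrt_le_real_sqrt
  have hln : 0 ≤ Real.log n := Real.log_nonneg (by linarith)
  have hs1 : 1 ≤ √(n : ℝ) := Real.one_le_sqrt.2 (by linarith)
  have hdiv : ∀ k ∈ Finset.range n, ((k / (n.sqrt + 1) : ℕ) : ℝ) + 1 ≤ √n + 1 := fun k hk => by
    have : k / (n.sqrt + 1) < n.sqrt + 1 :=
      Nat.div_lt_of_lt_mul ((Finset.mem_range.1 hk).trans (Nat.lt_succ_sqrt n))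
    have : ((k / (n.sqrt + 1) : ℕ) : ℝ) ≤ n.sqrt := by exact_mod_cast Nat.lt_succ_iff.1 this
    linarith
  have h1 : ∑ k ∈ Finset.range n, (((k / (n.sqrt + 1) : ℕ) : ℝ) + 1) * Real.log 2 ≤
      n * (√n + 1) := by
    calc _ ≤ ∑ k ∈ Finset.range n, (√n + 1) * 1 :=
          Finset.sum_le_sum fun k hk => mul_le_mul (hdiv k hk)
            (by linarith [Real.log_two_lt_d9]) (Real.log_nonneg (by norm_num)) (by positivity)
      _ = _ := by simp [mul_add]
  have h2 := sum_log_blocks_le hn (Nat.succ_pos n.sqrt)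
  simp only [log_blockBound hL (show (0 : ℝ) < n - 1 by linarith) (Nat.succ_pos n.sqrt)]
  rw [Finset.sum_add_distrib, Finset.sum_add_distrib, ← Finset.sum_mul,
    ← Finset.sum_mul, sum_range_cast, ← Finset.mul_sum]
  rw [← Finset.sum_mul] at h1
  have h3 : (n : ℝ) * (((n.sqrt.succ : ℕ) - 1) * (1 + Real.log n) + 3 + Real.log n) ≤
      5 * (n * √n * (1 + Real.log n)) := by
    push_cast
    have : (n.sqrt : ℝ) * (1 + Real.log n) ≤ √n * (1 + Real.log n) :=
      mul_le_mul_of_nonneg_right hs (by linarith)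
    have : 1 * (1 + Real.log n) ≤ √n * (1 + Real.log n) :=
      mul_le_mul_of_nonneg_right hs1 (by linarith)
    calc _ ≤ (n : ℝ) * (5 * (√n * (1 + Real.log n))) := by
          refine mul_le_mul_of_nonneg_left ?_ (by linarith)
          rw [add_sub_cancel_right]
          linarith
      _ = _ := by ring
  have h4 : (n : ℝ) * (√n + 1) ≤ 2 * (n * √n * (1 + Real.log n)) := by
    have : √n * 1 ≤ √n * (1 + Real.log n) :=
      mul_le_mul_of_nonneg_left (by linarith) (by linarith)
    calc _ ≤ (n : ℝ) * (2 * (√n * (1 + Real.log n))) :=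
          mul_le_mul_of_nonneg_left (by linarith) (by linarith)
      _ = _ := by ring
  have hU : 0 ≤ n * √n * (1 + Real.log n) := by positivity
  simp only [Nat.succ_eq_add_one] at *
  linarith

lemma log_arcsineFactor_ge {β e L : ℝ} (hL : 0 < L) (hLe : L ^ 2 * (e ^ 2 + 1 / 2) = 1) {n : ℕ}
    (hn : 0 < n) (k : ℕ) :
    Real.log L - 1 / 2 * Real.log n + β * (1 / 2 * (k * Real.log ((k + 1) / n)) - (k + 1) / 2 +
      k * Real.log (L / 2)) ≤ Real.log (arcsineFactor n β e (L * √((k + 1) / n)) k) := by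
  have hn' : (0 : ℝ) < n := by exact_mod_cast hn
  have hr2 : (L * √(((k : ℝ) + 1) / n)) ^ 2 * (e ^ 2 + 1 / 2) = (k + 1) / n := by
    rw [mul_pow, Real.sq_sqrt (by positivity), mul_right_comm, hLe, one_mul]
  have hpi : 0 ≤ Real.log (Real.pi / 2) :=
    Real.log_nonneg (by linarith [Real.pi_gt_three])
  have hpp := Real.pi_pos
  have hk : 0 ≤ Real.log ((k : ℝ) + 1) := Real.log_nonneg (by linarith [k.cast_nonneg (α := ℝ)])
  rw [arcsineFactor, hr2, Real.log_mul (by positivity) (by positivity), Real.log_exp,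
    show Real.pi * (L * √(((k : ℝ) + 1) / n) / 2) = Real.pi / 2 * (L * √(((k : ℝ) + 1) / n)) by ring,
    show L * √(((k : ℝ) + 1) / n) / 2 = L / 2 * √(((k : ℝ) + 1) / n) by ring,
    Real.log_mul (by positivity) (by positivity), Real.log_mul (by positivity) (by positivity),
    Real.log_mul (by positivity) (by positivity), Real.log_sqrt (by positivity)]
  have h : -((n : ℝ) / 2) * ((k + 1) / n) = -((k + 1) / 2) := by field_simp
  rw [h]
  have h5 : Real.log (((k : ℝ) + 1) / n) / 2 ≥ - (1 / 2 * Real.log n) := by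
    rw [Real.log_div (by positivity) (by positivity)]
    linarith
  have : β * (-((k + 1) / 2) + k * (Real.log (L / 2) + Real.log (((k : ℝ) + 1) / n) / 2)) =
    β * (1 / 2 * (k * Real.log ((k + 1) / n)) - (k + 1) / 2 + k * Real.log (L / 2)) := by ring
  linarith

lemma sum_log_arcsineFactor_ge {β e L : ℝ} (hL : 0 < L) (hLe : L ^ 2 * (e ^ 2 + 1 / 2) = 1) {n : ℕ}
    (hn : 0 < n) :
    n * Real.log L - n / 2 * Real.log n + β * (commonEnergy n + n * (n - 1) / 2 * Real.log (L / 2)) ≤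
      ∑ k ∈ Finset.range n, Real.log (arcsineFactor n β e (L * √((k + 1) / n)) k) := by
  refine le_trans (le_of_eq ?_)
    (Finset.sum_le_sum fun k _ => log_arcsineFactor_ge (β := β) hL hLe hn k)
  simp only [Finset.sum_add_distrib, Finset.sum_sub_distrib, ← Finset.mul_sum, ← Finset.sum_mul,
    ← Finset.sum_div, Finset.sum_const, Finset.card_range, nsmul_eq_mul, sum_range_cast,
    commonEnergy]
  ring

open MeasureTheory in
/-- Two-sided estimate, with an error of order `n ^ (3 / 2) * log n`, for the logarithm of the
partition function of a `β`-ensemble confined to `S`. -/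
lemma exists_abs_log_integral_ensembleDensity_sub_le {S : Set ℝ} {e L β : ℝ}
    (hGS : GreenSumBound S e L) (hSm : MeasurableSet S) (hL : 0 < L) (hβ : 0 < β)
    (he0 : 0 ≤ e) (he1 : e ≤ 1) (hS : ∀ r > 0, Set.Icc (r * (e - 1)) (r * (e + 1)) ⊆ S)
    (hLe : L ^ 2 * (e ^ 2 + 1 / 2) = 1) :
    ∃ C : ℝ, ∀ n : ℕ, 2 ≤ n →
      0 < ∫ x in {x : Fin n → ℝ | ∀ i, x i ∈ S}, ensembleDensity n β n x ∧
      |Real.log (∫ x in {x : Fin n → ℝ | ∀ i, x i ∈ S}, ensembleDensity n β n x) -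
        (β * commonEnergy n + β / 2 * Real.log (L / 2) * n ^ 2)| ≤
          C * (n * √n * (1 + Real.log n)) := by
  refine ⟨6 * β + |Real.log (Real.pi / (β / 2))| + β * |Real.log (L / 2)| + |Real.log L| + 1,
    fun n hn => ?_⟩
  have hn' : (2 : ℝ) ≤ n := by exact_mod_cast hn
  have hn0 : (0 : ℝ) < n := by linarith
  have hln : 0 ≤ Real.log n := Real.log_nonneg (by linarith)
  have hs1 : 1 ≤ √(n : ℝ) := Real.one_le_sqrt.2 (by linarith)
  obtain ⟨hint, hub⟩ := integrableOn_ensembleDensity_and_le hGS hSm hL hβ hn (Nat.succ_pos n.sqrt)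
  have hlb := prod_arcsineFactor_le_integral (a := n) (ρ := fun k => L * √(((k : ℝ) + 1) / n)) hβ
    he0 he1 hS (fun k => by positivity) (fun i j hij => by dsimp only; gcongr) hint
  have hpp := Real.pi_pos
  have hf0 : ∀ k ∈ Finset.range n, 0 < arcsineFactor n β e (L * √(((k : ℝ) + 1) / n)) k :=
    fun k _ => by unfold arcsineFactor; positivity
  have hP := Finset.prod_pos hf0
  have hZ := hP.trans_le hlb
  refine ⟨hZ, ?_⟩
  have hb0 : ∀ k ∈ Finset.range n, 0 < blockBound L (n - 1) (n.sqrt + 1) k := fun k _ =>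
    blockBound_pos hL (by linarith) (Nat.succ_pos _) k
  have hL1 := Real.log_le_log hP hlb
  rw [Real.log_prod fun k hk => (hf0 k hk).ne'] at hL1
  have hU1 := Real.log_le_log hZ hub
  simp only [Nat.succ_eq_add_one] at hU1
  have hBP := Finset.prod_pos hb0
  rw [Real.log_mul (by positivity) (by positivity), Real.log_rpow (by positivity), Real.log_pow,
    Real.log_sqrt (by positivity), Real.log_mul (by positivity) hBP.ne',
    Real.log_prod fun k hk => (hb0 k hk).ne'] at hU1
  have hlow := sum_log_arcsineFactor_ge (β := β) hL hLe (show 0 < n by omega)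
  have hup := mul_le_mul_of_nonneg_left (sum_log_blockBound_le hL hn) hβ.le
  have hfac : Real.log n.factorial ≤ n * Real.log n := by
    rw [← Real.log_pow]
    exact Real.log_le_log (by positivity) (by exact_mod_cast Nat.factorial_le_pow n)
  have hfac' := mul_le_mul_of_nonneg_left hfac hβ.le
  set U : ℝ := n * √n * (1 + Real.log n) with hUdef
  have hU2 : (n : ℝ) * (1 + Real.log n) ≤ U := by
    have : (n : ℝ) * (1 + Real.log n) * 1 ≤ n * (1 + Real.log n) * √n :=
      mul_le_mul_of_nonneg_left hs1 (by positivity)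
    linarith
  have hU3 : (n : ℝ) * Real.log n ≤ U := by linarith
  have hU4 : (n : ℝ) ≤ U := by nlinarith
  have e1 := mul_le_mul_of_nonneg_left hU3 hβ.le
  have e2 := mul_le_mul_of_nonneg_left hU4 (abs_nonneg (Real.log (Real.pi / (β / 2))))
  have e3 := mul_le_mul_of_nonneg_left hU4 (mul_nonneg hβ.le (abs_nonneg (Real.log (L / 2))))
  have e4 := mul_le_mul_of_nonneg_left hU4 (abs_nonneg (Real.log L))
  have g2 := mul_le_mul_of_nonneg_right (le_abs_self (Real.log (Real.pi / (β / 2)))) hn0.le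
  have g2' := mul_nonneg (abs_nonneg (Real.log (Real.pi / (β / 2)))) hn0.le
  have g3 := mul_le_mul_of_nonneg_right (le_abs_self (Real.log (L / 2))) (mul_pos hβ hn0).le
  have g3' := mul_le_mul_of_nonneg_right (neg_abs_le (Real.log (L / 2))) (mul_pos hβ hn0).le
  have g3'' := mul_nonneg (abs_nonneg (Real.log (L / 2))) (mul_pos hβ hn0).le
  have g4 := mul_le_mul_of_nonneg_right (neg_abs_le (Real.log L)) hn0.le
  have g4' := mul_nonneg (abs_nonneg (Real.log L)) hn0.le
  have hβU : 0 ≤ β * U := mul_nonneg hβ.le (by positivity)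
  have i1 : (n : ℝ) * (Real.log (Real.pi / (β / 2)) / 2) ≤
    |Real.log (Real.pi / (β / 2))| * n / 2 := by linarith
  rw [abs_le]
  constructor <;> linarith

lemma tendsto_one_add_log_div_sqrt :
    Tendsto (fun n : ℕ => (1 + Real.log n) / √(n : ℝ)) atTop (𝓝 0) := by
  have h1 : Tendsto (fun x : ℝ => (1 + Real.log x) / √x) atTop (𝓝 0) := by
    refine Asymptotics.IsLittleO.tendsto_div_nhds_zero ?_
    rw [show Real.sqrt = fun x => x ^ (1 / 2 : ℝ) from funext Real.sqrt_eq_rpow]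
    refine Asymptotics.IsLittleO.add ?_ (isLittleO_log_rpow_atTop (by norm_num))
    rw [Asymptotics.isLittleO_const_left]
    exact Or.inr (tendsto_norm_atTop_atTop.comp (tendsto_rpow_atTop (by norm_num)))
  exact h1.comp tendsto_natCast_atTop_atTop

/-- The probability that all eigenvalues of a Gaussian β-ensemble matrix are
positive decays as `exp(−(β/4)(log 3) n²)`:
`lim (1/n²) log(Z_n⁰/Z_n) = −(β/4) log 3`. -/
theorem prob_all_positive_decay (β : ℝ) (hβ : 0 < β) :
    Tendsto (fun n : ℕ => (1 / (n : ℝ) ^ 2) * Real.log (Zplus β n / Ztot β n))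
      atTop (𝓝 (-(β / 4) * Real.log 3)) := by
  have hG1 : GreenSumBound Set.univ 0 √2 := fun δ hδ J x _ => sum_intervalGreen_line hδ J x
  have hG2 : GreenSumBound (Set.Ici 0) 1 √(2 / 3) := fun δ hδ J x hx =>
    sum_intervalGreen_half_line hδ J hx
  obtain ⟨C₁, h₁⟩ := exists_abs_log_integral_ensembleDensity_sub_le hG1 MeasurableSet.univ
    (by positivity) hβ le_rfl zero_le_one (fun r _ => Set.subset_univ _)
    (by rw [Real.sq_sqrt (by norm_num)]; norm_num)
  obtain ⟨C₂, h₂⟩ := exists_abs_log_integral_ensembleDensity_sub_le hG2 measurableSet_Ici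
    (by positivity) hβ zero_le_one le_rfl
    (fun r _ x hx => by simpa using hx.1)
    (by rw [Real.sq_sqrt (by norm_num)]; norm_num)
  have hZtot : ∀ n, ∫ x in {x : Fin n → ℝ | ∀ i, x i ∈ Set.univ}, ensembleDensity n β n x =
      Ztot β n := fun n => by
    simp [Ztot, ensembleDensity]
  have hZplus : ∀ n, ∫ x in {x : Fin n → ℝ | ∀ i, x i ∈ Set.Ici 0}, ensembleDensity n β n x =
      Zplus β n := fun n => rfl
  simp only [hZtot] at h₁
  simp only [hZplus] at h₂
  have hlog : Real.log (√(2 / 3) / 2) - Real.log (√2 / 2) = -(1 / 2) * Real.log 3 := by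
    rw [Real.log_div (by positivity) (by norm_num), Real.log_div (by positivity) (by norm_num),
      Real.log_sqrt (by norm_num), Real.log_sqrt (by norm_num), Real.log_div (by norm_num)
        (by norm_num)]
    ring
  have hlim := tendsto_one_add_log_div_sqrt.const_mul (C₁ + C₂)
  rw [mul_zero] at hlim
  rw [tendsto_iff_norm_sub_tendsto_zero]
  refine squeeze_zero' (Eventually.of_forall fun n => norm_nonneg _) ?_ hlim
  filter_upwards [eventually_ge_atTop 2] with n hn
  obtain ⟨hp₁, hb₁⟩ := h₁ n hn
  obtain ⟨hp₂, hb₂⟩ := h₂ n hn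
  have hn0 : (0 : ℝ) < n := by exact_mod_cast (by omega : 0 < n)
  rw [Real.log_div hp₂.ne' hp₁.ne', Real.norm_eq_abs]
  have key : |Real.log (Zplus β n) - Real.log (Ztot β n) - -(β / 4) * Real.log 3 * n ^ 2| ≤
      (C₁ + C₂) * (n * √n * (1 + Real.log n)) := by
    have : Real.log (Zplus β n) - Real.log (Ztot β n) - -(β / 4) * Real.log 3 * n ^ 2 =
        (Real.log (Zplus β n) - (β * commonEnergy n + β / 2 * Real.log (√(2 / 3) / 2) * n ^ 2)) -
        (Real.log (Ztot β n) - (β * commonEnergy n + β / 2 * Real.log (√2 / 2) * n ^ 2)) := by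
      linear_combination β / 2 * (n : ℝ) ^ 2 * hlog
    rw [this]
    exact (abs_sub _ _).trans (by linarith)
  have hsq : √(n : ℝ) * √n = n := Real.mul_self_sqrt hn0.le
  calc |1 / (n : ℝ) ^ 2 * (Real.log (Zplus β n) - Real.log (Ztot β n)) - -(β / 4) * Real.log 3|
      = |Real.log (Zplus β n) - Real.log (Ztot β n) - -(β / 4) * Real.log 3 * n ^ 2| / (n : ℝ) ^ 2 := by
        rw [← abs_of_pos (pow_pos hn0 2), ← abs_div, abs_of_pos (pow_pos hn0 2)]
        congr 1
        field_simp
    _ ≤ (C₁ + C₂) * (n * √n * (1 + Real.log n)) / (n : ℝ) ^ 2 := by gcongr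
    _ = (C₁ + C₂) * ((1 + Real.log n) / √n) := by
        have h0 : √(n : ℝ) ≠ 0 := by positivity
        field_simp
        rw [sq, hsq]
end
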